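/- Let μ be a probability measure on ℝ with characteristic function φ(t) = U(t) + iV(t), intermediate distribution function F, tail sum H(x) = 1 − F(x) + F(−x) and tail difference K(x) = 1 − F(x) − F(−x) for x > 0. Let 0 < k < 2 with k ≠ 1. Suppose: (a) 1 − U(t) > 0 for all sufficiently small t > 0 and (1 − U(λt))/(1 − U(t)) → λ^k as t ↓ 0 for every λ > 0 (1 − U is regularly varying at 0 with index k); and (b) V(t)/(1 − U(t)) → c' as t ↓ 0 for some real c'. Then H(x) > 0 for all sufficiently large x, the limit β := lim_{x→∞} K(x)/H(x) exists, β ∈ [−1, 1], and c' = β tan(πk/2). -/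

import Mathlib

open MeasureTheory Complex Filter

/-- The characteristic function of a measure on ℝ. -/
noncomputable def charFun' (μ : Measure ℝ) (t : ℝ) : ℂ :=
  ∫ x, Complex.exp (Complex.I * t * x) ∂μ

/-- The intermediate distribution function `F(x) = (μ(-∞,x) + μ(-∞,x])/2`. -/
noncomputable def interDF (μ : Measure ℝ) (x : ℝ) : ℝ :=
  ((μ (Set.Iio x)).toReal + (μ (Set.Iic x)).toReal) / 2

/-- The tail sum `H(x) = 1 - F(x) + F(-x)`. -/
noncomputable def tailSum (μ : Measure ℝ) (x : ℝ) : ℝ :=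
  1 - interDF μ x + interDF μ (-x)

/-- The tail difference `K(x) = 1 - F(x) - F(-x)`. -/
noncomputable def tailDiff (μ : Measure ℝ) (x : ℝ) : ℝ :=
  1 - interDF μ x - interDF μ (-x)

lemma integrable_cexp_mul_I (s : ℝ) (η : Measure ℝ) [IsFiniteMeasure η] :
    Integrable (fun x : ℝ => Complex.exp (s * x * I)) η := by
  refine Integrable.of_bound (C := 1) (by fun_prop) (ae_of_all _ fun x => ?_)
  rw [← Complex.ofReal_mul, Complex.norm_exp_ofReal_mul_I]

/-- Lévy's convergence theorem for finite measures. -/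
lemma tendsto_integral_of_tendsto_charFun {σ : ℕ → Measure ℝ} {σ₀ : Measure ℝ}
    [∀ n, IsFiniteMeasure (σ n)] [IsFiniteMeasure σ₀]
    (h : ∀ s : ℝ, Tendsto (fun n => charFun (σ n) s) atTop (nhds (charFun σ₀ s)))
    (f : BoundedContinuousFunction ℝ ℝ) :
    Tendsto (fun n => ∫ x, f x ∂(σ n)) atTop (nhds (∫ x, f x ∂σ₀)) := by
  -- adding a Dirac mass makes the total masses positive
  have key : ∀ (τ : Measure ℝ) [IsFiniteMeasure τ],
      ∃ P : ProbabilityMeasure ℝ, (∀ s : ℝ, charFun (P : Measure ℝ) s =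
        ((τ.real Set.univ + 1 : ℝ) : ℂ)⁻¹ * (charFun τ s + 1)) ∧
        ∫ x, f x ∂(P : Measure ℝ) = (τ.real Set.univ + 1)⁻¹ * (∫ x, f x ∂τ + f 0) := by
    intro τ _
    have hm : (τ + Measure.dirac 0).real Set.univ = τ.real Set.univ + 1 := by
      simp [measureReal_add_apply]
    have hpos : 0 < τ.real Set.univ + 1 := by positivity
    set c : NNReal := (Real.toNNReal (τ.real Set.univ + 1))⁻¹ with hc
    have hcr : (c : ℝ) = (τ.real Set.univ + 1)⁻¹ := by
      simp [hc]
    have hP : IsProbabilityMeasure (c • (τ + Measure.dirac (0 : ℝ))) := by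
      have : (c • (τ + Measure.dirac (0 : ℝ))).real Set.univ = 1 := by
        rw [measureReal_nnreal_smul_apply, hm, hcr, inv_mul_cancel₀ hpos.ne']
      refine ⟨?_⟩
      have h2 := ENNReal.ofReal_toReal (measure_ne_top (c • (τ + Measure.dirac (0 : ℝ))) Set.univ)
      rw [← h2]
      rw [Measure.real] at this
      rw [this]; simp
    refine ⟨⟨c • (τ + Measure.dirac (0 : ℝ)), hP⟩, fun s => ?_, ?_⟩
    · simp only [ProbabilityMeasure.coe_mk, charFun_apply_real]
      rw [integral_smul_nnreal_measure,
        integral_add_measure (integrable_cexp_mul_I _ _) (integrable_cexp_mul_I _ _)]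
      simp only [integral_dirac, NNReal.smul_def, hcr]
      simp
      ring
    · simp only [ProbabilityMeasure.coe_mk]
      rw [integral_smul_nnreal_measure, integral_add_measure (f.integrable _) (f.integrable _)]
      simp [NNReal.smul_def, hcr]
      ring
  choose P hP using fun n => key (σ n)
  obtain ⟨P₀, hP₀⟩ := key σ₀
  have hmass : Tendsto (fun n => (σ n).real Set.univ) atTop (nhds (σ₀.real Set.univ)) := by
    have := h 0
    simp only [charFun_zero] at this
    exact_mod_cast (Complex.continuous_re.tendsto _).comp this
  have hw : Tendsto P atTop (nhds P₀) := by
    refine ProbabilityMeasure.tendsto_of_tendsto_charFun fun s => ?_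
    simp only [(hP _).1, hP₀.1]
    refine Tendsto.mul (Tendsto.inv₀ ?_ ?_) ((h s).add_const 1)
    · exact (Complex.continuous_ofReal.tendsto _).comp (hmass.add_const 1)
    · have : 0 < σ₀.real Set.univ + 1 := by positivity
      exact_mod_cast this.ne'
  have := (ProbabilityMeasure.tendsto_iff_forall_integral_tendsto.1 hw) f
  simp only [(hP _).2, hP₀.2] at this
  have h2 := ((hmass.add_const 1).mul this).sub_const (f 0)
  have aux : ∀ m y : ℝ, 0 ≤ m → (m + 1) * ((m + 1)⁻¹ * (y + f 0)) - f 0 = y := by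
    intro m y hm
    field_simp; ring
  simpa only [aux _ _ measureReal_nonneg] using h2

/-- Lévy's convergence theorem for a limit given as a signed combination of finite measures. -/
lemma tendsto_integral_of_tendsto_charFun_combination {ρ : ℕ → Measure ℝ} {ρ₁ ρ₂ : Measure ℝ}
    [∀ n, IsFiniteMeasure (ρ n)] [IsFiniteMeasure ρ₁] [IsFiniteMeasure ρ₂] {a b : ℝ}
    (h : ∀ s : ℝ, Tendsto (fun n => charFun (ρ n) s) atTop
      (nhds (a * charFun ρ₁ s + b * charFun ρ₂ s)))
    (f : BoundedContinuousFunction ℝ ℝ) :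
    Tendsto (fun n => ∫ x, f x ∂(ρ n)) atTop
      (nhds (a * ∫ x, f x ∂ρ₁ + b * ∫ x, f x ∂ρ₂)) := by
  have hc : ∀ (u v : NNReal) (s : ℝ), charFun (u • ρ₁ + v • ρ₂) s =
      (u : ℝ) * charFun ρ₁ s + (v : ℝ) * charFun ρ₂ s := by
    intro u v s
    simp only [charFun_apply_real]
    rw [integral_add_measure (integrable_cexp_mul_I _ _) (integrable_cexp_mul_I _ _),
      integral_smul_nnreal_measure,
      integral_smul_nnreal_measure]
    simp [NNReal.smul_def]
  have hf : ∀ (u v : NNReal), ∫ x, f x ∂(u • ρ₁ + v • ρ₂) =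
      (u : ℝ) * ∫ x, f x ∂ρ₁ + (v : ℝ) * ∫ x, f x ∂ρ₂ := by
    intro u v
    rw [integral_add_measure (f.integrable _) (f.integrable _), integral_smul_nnreal_measure,
      integral_smul_nnreal_measure]
    simp [NNReal.smul_def]
  have hca : ((Real.toNNReal a : ℝ)) - (Real.toNNReal (-a) : ℝ) = a := by
    simp only [Real.coe_toNNReal']
    rcases le_total a 0 with ha | ha
    · rw [max_eq_right ha, max_eq_left (by linarith)]; ring
    · rw [max_eq_left ha, max_eq_right (by linarith)]; ring
  have hcb : ((Real.toNNReal b : ℝ)) - (Real.toNNReal (-b) : ℝ) = b := by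
    simp only [Real.coe_toNNReal']
    rcases le_total b 0 with ha | ha
    · rw [max_eq_right ha, max_eq_left (by linarith)]; ring
    · rw [max_eq_left ha, max_eq_right (by linarith)]; ring
  set a₁ := Real.toNNReal a
  set a₂ := Real.toNNReal (-a)
  set b₁ := Real.toNNReal b
  set b₂ := Real.toNNReal (-b)
  have key := tendsto_integral_of_tendsto_charFun
    (σ := fun n => ρ n + (a₂ • ρ₁ + b₂ • ρ₂)) (σ₀ := a₁ • ρ₁ + b₁ • ρ₂) (fun s => by
      have e : ∀ n, charFun (ρ n + (a₂ • ρ₁ + b₂ • ρ₂)) s =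
          charFun (ρ n) s + charFun (a₂ • ρ₁ + b₂ • ρ₂) s := by
        intro n
        simp only [charFun_apply_real]
        rw [integral_add_measure (integrable_cexp_mul_I _ _) (integrable_cexp_mul_I _ _)]
      simp only [e]
      convert! (h s).add_const (charFun (a₂ • ρ₁ + b₂ • ρ₂) s) using 2
      rw [hc, hc, ← hca, ← hcb]
      push_cast
      ring) f
  have e : ∀ n, ∫ x, f x ∂(ρ n + (a₂ • ρ₁ + b₂ • ρ₂)) =
      ∫ x, f x ∂(ρ n) + ∫ x, f x ∂(a₂ • ρ₁ + b₂ • ρ₂) := fun n => by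
    rw [integral_add_measure (f.integrable _) (f.integrable _)]
  simp only [e] at key
  have := key.sub_const (∫ x, f x ∂(a₂ • ρ₁ + b₂ • ρ₂))
  simp only [add_sub_cancel_right, hf] at this
  convert! this using 2
  rw [← hca, ← hcb]
  ring

lemma integrableOn_min_one_mul_rpow {α : ℝ} (h0 : 0 < α) (h1 : α < 1) :
    IntegrableOn (fun x : ℝ => min 1 x * x ^ (-1 - α)) (Set.Ioi 0) := by
  rw [← Set.Ioc_union_Ioi_eq_Ioi zero_le_one]
  refine IntegrableOn.union ?_ ?_
  · have : IntegrableOn (fun x : ℝ => x ^ (-α)) (Set.Ioc 0 1) :=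
      (intervalIntegrable_iff_integrableOn_Ioc_of_le zero_le_one).1
        (intervalIntegral.intervalIntegrable_rpow' (by linarith))
    refine this.congr_fun (fun x hx => ?_) measurableSet_Ioc
    simp only
    rw [min_eq_right hx.2, show -α = 1 + (-1 - α) by ring, Real.rpow_add hx.1, Real.rpow_one]
  · refine (integrableOn_Ioi_rpow_of_lt (a := -1 - α) (by linarith) zero_lt_one).congr_fun
      (fun x hx => ?_) measurableSet_Ioi
    simp only
    rw [min_eq_left (le_of_lt hx), one_mul]

lemma norm_one_sub_cexp_neg_le {w : ℂ} (hw : 0 ≤ w.re) : ‖1 - cexp (-w)‖ ≤ ‖w‖ := by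
  have := (convex_halfSpace_re_le 0).norm_image_sub_le_of_norm_hasDerivWithin_le
    (f := cexp) (f' := cexp) (C := 1) (x := -w) (y := 0)
    (fun x _ => (Complex.hasDerivAt_exp x).hasDerivWithinAt)
    (fun x hx => by
      rw [Complex.norm_exp]
      exact Real.exp_le_one_iff.2 hx) (by simpa using hw) (by simp)
  simpa using this

lemma norm_one_sub_cexp_neg_le_two {w : ℂ} (hw : 0 ≤ w.re) : ‖1 - cexp (-w)‖ ≤ 2 := by
  refine (norm_sub_le _ _).trans ?_
  have : ‖cexp (-w)‖ ≤ 1 := by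
    rw [Complex.norm_exp]
    exact Real.exp_le_one_iff.2 (by simpa using hw)
  rw [norm_one]
  linarith

lemma norm_one_sub_cexp_neg_mul_le {z : ℂ} (hz : 0 ≤ z.re) {x : ℝ} (hx : 0 ≤ x) :
    ‖1 - cexp (-(z * x))‖ ≤ (2 + ‖z‖) * min 1 x := by
  have hre : 0 ≤ (z * x).re := by simpa using mul_nonneg hz hx
  rcases le_total 1 x with h | h
  · rw [min_eq_left h]
    linarith [norm_one_sub_cexp_neg_le_two hre, norm_nonneg z]
  · rw [min_eq_right h]
    have := norm_one_sub_cexp_neg_le hre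
    rw [norm_mul, Complex.norm_real, Real.norm_of_nonneg hx] at this
    nlinarith

/-- The Laplace exponent of the one-sided stable Lévy measure of index `α`. -/
noncomputable def stableExponent (α : ℝ) (z : ℂ) : ℂ :=
  ∫ x in Set.Ioi (0 : ℝ), (1 - cexp (-(z * x))) * ((x ^ (-1 - α) : ℝ) : ℂ)

lemma norm_stable_integrand_le {α : ℝ} {z : ℂ} (hz : 0 ≤ z.re) {x : ℝ} (hx : 0 < x) :
    ‖(1 - cexp (-(z * x))) * ((x ^ (-1 - α) : ℝ) : ℂ)‖ ≤
      (2 + ‖z‖) * (min 1 x * x ^ (-1 - α)) := by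
  have hp : 0 ≤ x ^ (-1 - α) := Real.rpow_nonneg hx.le _
  rw [norm_mul, Complex.norm_real, Real.norm_of_nonneg hp, ← mul_assoc]
  exact mul_le_mul_of_nonneg_right (norm_one_sub_cexp_neg_mul_le hz hx.le) hp

lemma aestronglyMeasurable_stable_integrand (α : ℝ) (z : ℂ) (ν : Measure ℝ) :
    AEStronglyMeasurable (fun x : ℝ => (1 - cexp (-(z * x))) * ((x ^ (-1 - α) : ℝ) : ℂ)) ν :=
  Measurable.aestronglyMeasurable (by fun_prop)

lemma continuousOn_stableExponent {α : ℝ} (h0 : 0 < α) (h1 : α < 1) :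
    ContinuousOn (stableExponent α) {z | 0 ≤ z.re} := by
  intro z₀ hz₀
  refine continuousWithinAt_of_dominated
    (bound := fun x => (2 + (‖z₀‖ + 1)) * (min 1 x * x ^ (-1 - α))) ?_ ?_ ?_ ?_
  · exact Eventually.of_forall fun z => aestronglyMeasurable_stable_integrand α z _
  · have hb : ∀ᶠ z : ℂ in nhdsWithin z₀ {z | 0 ≤ z.re}, ‖z‖ < ‖z₀‖ + 1 :=
      (continuous_norm.continuousAt.eventually_lt_const (lt_add_one _)).filter_mono
        nhdsWithin_le_nhds
    filter_upwards [hb, self_mem_nhdsWithin] with z hz hz'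
    filter_upwards [ae_restrict_mem measurableSet_Ioi] with x hx
    have hx' : (0 : ℝ) < x := hx
    refine (norm_stable_integrand_le hz' hx').trans ?_
    gcongr
  · exact (integrableOn_min_one_mul_rpow h0 h1).const_mul _
  · exact ae_of_all _ fun x => (Continuous.continuousWithinAt (by fun_prop))

lemma differentiableOn_stableExponent {α : ℝ} (h0 : 0 < α) (h1 : α < 1) :
    DifferentiableOn ℂ (stableExponent α) {z | 0 < z.re} := by
  intro z₀ hz₀
  have hz₀' : 0 < z₀.re := hz₀
  refine DifferentiableAt.differentiableWithinAt (HasDerivAt.differentiableAt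
    (hasDerivAt_integral_of_dominated_loc_of_deriv_le (s := {z | z₀.re / 2 < z.re})
    (F' := fun (z : ℂ) (x : ℝ) => (x : ℂ) * cexp (-(z * x)) * ((x ^ (-1 - α) : ℝ) : ℂ))
    (bound := fun x => x ^ (-α) * Real.exp (-(z₀.re / 2) * x ^ (1 : ℝ)))
    ?_ ?_ ?_ ?_ ?_ ?_ ?_).2)
  · exact (isOpen_lt continuous_const Complex.continuous_re).mem_nhds
      (show z₀.re / 2 < z₀.re by linarith)
  · exact Eventually.of_forall fun z => aestronglyMeasurable_stable_integrand α z _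
  · refine Integrable.mono' ((integrableOn_min_one_mul_rpow h0 h1).const_mul (2 + ‖z₀‖))
      (aestronglyMeasurable_stable_integrand α z₀ _) ?_
    filter_upwards [ae_restrict_mem measurableSet_Ioi] with x hx
    exact norm_stable_integrand_le hz₀'.le hx
  · exact Measurable.aestronglyMeasurable (by fun_prop)
  · filter_upwards [ae_restrict_mem measurableSet_Ioi] with x hx z hz
    have hx' : (0 : ℝ) < x := hx
    have hz' : z₀.re / 2 < z.re := hz
    rw [norm_mul, norm_mul, Complex.norm_real, Complex.norm_real, Complex.norm_exp,
      Real.norm_of_nonneg hx'.le, Real.norm_of_nonneg (Real.rpow_nonneg hx'.le _),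
      show -α = 1 + (-1 - α) by ring, Real.rpow_add hx', Real.rpow_one]
    have : Real.exp (-(z * x)).re ≤ Real.exp (-(z₀.re / 2) * x) := by
      refine Real.exp_le_exp.2 ?_
      simp only [neg_re, mul_re, ofReal_re, ofReal_im, mul_zero, sub_zero]
      nlinarith
    have hp : 0 ≤ x * x ^ (-1 - α) := by positivity
    nlinarith
  · exact integrableOn_rpow_mul_exp_neg_mul_rpow (by linarith) one_pos (by linarith)
  · filter_upwards with x z _
    have : HasDerivAt (fun z : ℂ => 1 - cexp (-(z * x))) (x * cexp (-(z * x))) z := by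
      have h := ((((hasDerivAt_id z).mul_const (x : ℂ)).neg).cexp).const_sub 1
      convert! h using 1
      simp [mul_comm]
    exact this.mul_const _

lemma stableExponent_ofReal {α : ℝ} {r : ℝ} (hr : 0 < r) :
    stableExponent α r = ((r ^ α : ℝ) : ℂ) * stableExponent α 1 := by
  have h := integral_comp_mul_left_Ioi'
    (fun x : ℝ => (1 - cexp (-(1 * x))) * ((x ^ (-1 - α) : ℝ) : ℂ)) 0 hr
  rw [mul_zero] at h
  unfold stableExponent
  rw [← h, ← integral_smul, ← integral_const_mul]
  refine setIntegral_congr_fun measurableSet_Ioi fun x hx => ?_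
  have hx' : (0 : ℝ) < x := hx
  simp only [one_mul, Complex.real_smul]
  rw [Real.mul_rpow hr.le hx'.le]
  have : r ^ α * r * r ^ (-1 - α) = 1 := by
    rw [← Real.rpow_add_one hr.ne', ← Real.rpow_add hr, show α + 1 + (-1 - α) = 0 by ring,
      Real.rpow_zero]
  have h2 : ((r ^ α : ℝ) : ℂ) * r * ((r ^ (-1 - α) : ℝ) : ℂ) = 1 := by exact_mod_cast this
  push_cast
  linear_combination (-(1 - cexp (-(r * x))) * ((x ^ (-1 - α) : ℝ) : ℂ)) * h2

lemma stableExponent_one_pos {α : ℝ} (h0 : 0 < α) (h1 : α < 1) :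
    ∃ A : ℝ, 0 < A ∧ stableExponent α 1 = A := by
  refine ⟨∫ x in Set.Ioi (0 : ℝ), (1 - Real.exp (-x)) * x ^ (-1 - α), ?_, ?_⟩
  · have hpos : ∀ x ∈ Set.Ioi (0 : ℝ), 0 < (1 - Real.exp (-x)) * x ^ (-1 - α) := by
      intro x hx
      have hx' : (0 : ℝ) < x := hx
      have : Real.exp (-x) < 1 := Real.exp_lt_one_iff.2 (by linarith)
      have := Real.rpow_pos_of_pos hx' (-1 - α)
      exact mul_pos (by linarith) this
    rw [setIntegral_pos_iff_support_of_nonneg_ae]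
    · rw [Set.inter_eq_right.2 (fun x hx => Function.mem_support.2 (hpos x hx).ne')]
      simp
    · filter_upwards [ae_restrict_mem measurableSet_Ioi] with x hx
      exact (hpos x hx).le
    · refine Integrable.mono' ((integrableOn_min_one_mul_rpow h0 h1).const_mul (2 + ‖(1 : ℂ)‖))
        (Measurable.aestronglyMeasurable (by fun_prop)) ?_
      filter_upwards [ae_restrict_mem measurableSet_Ioi] with x hx
      refine le_trans (le_of_eq ?_) (norm_stable_integrand_le (z := 1) (by simp) hx)
      rw [← Complex.norm_real]
      push_cast
      simp
  · rw [stableExponent, ← integral_complex_ofReal]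
    refine setIntegral_congr_fun measurableSet_Ioi fun x hx => ?_
    push_cast
    simp

lemma stableExponent_eq {α : ℝ} (h0 : 0 < α) (h1 : α < 1) {z : ℂ} (hz : 0 ≤ z.re) (hz0 : z ≠ 0) :
    stableExponent α z = stableExponent α 1 * z ^ (α : ℂ) := by
  have hopen : IsOpen {z : ℂ | 0 < z.re} := isOpen_lt continuous_const Complex.continuous_re
  have hsub : ∀ z : ℂ, 0 < z.re → stableExponent α z = stableExponent α 1 * z ^ (α : ℂ) := by
    have := AnalyticOnNhd.eqOn_of_preconnected_of_frequently_eq (z₀ := (1 : ℂ))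
      ((differentiableOn_stableExponent h0 h1).analyticOnNhd hopen)
      (g := fun z => stableExponent α 1 * z ^ (α : ℂ))
      (DifferentiableOn.analyticOnNhd (fun z hz =>
        (DifferentiableAt.const_mul (differentiableAt_id.cpow (differentiableAt_const _)
          (Or.inl hz)) _).differentiableWithinAt) hopen)
      (convex_halfSpace_re_gt 0).isPreconnected (by simp) ?_
    · exact fun z hz => this hz
    · have ht : Tendsto (fun n : ℕ => ((1 + 1 / ((n : ℝ) + 1) : ℝ) : ℂ)) atTop
          (nhdsWithin 1 {1}ᶜ) := by
        refine tendsto_nhdsWithin_iff.2 ⟨?_, Eventually.of_forall fun n => ?_⟩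
        · have := (tendsto_one_div_add_atTop_nhds_zero_nat (𝕜 := ℝ)).const_add 1
          rw [add_zero] at this
          exact (Complex.continuous_ofReal.tendsto 1).comp this
        · have : (0 : ℝ) < 1 / ((n : ℝ) + 1) := by positivity
          simp only [Set.mem_compl_iff, Set.mem_singleton_iff]
          intro h
          have h' : (1 + 1 / ((n : ℝ) + 1) : ℝ) = 1 := by exact_mod_cast h
          linarith
      refine ht.frequently (Frequently.of_forall fun n => ?_)
      have hr : (0 : ℝ) < 1 + 1 / ((n : ℝ) + 1) := by positivity
      rw [stableExponent_ofReal hr, mul_comm, Complex.ofReal_cpow hr.le]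
  have hslit : z ∈ Complex.slitPlane := by
    rcases hz.lt_or_eq with h | h
    · exact Or.inl h
    · refine Or.inr fun him => hz0 (Complex.ext h.symm him)
  have hlim : Tendsto (fun n : ℕ => z + ((1 / ((n : ℝ) + 1) : ℝ) : ℂ)) atTop (nhds z) := by
    have := (Complex.continuous_ofReal.tendsto 0).comp
      (tendsto_one_div_add_atTop_nhds_zero_nat (𝕜 := ℝ))
    simpa using this.const_add z
  have hre : ∀ n : ℕ, 0 < (z + ((1 / ((n : ℝ) + 1) : ℝ) : ℂ)).re := by
    intro n
    have : (0 : ℝ) < 1 / ((n : ℝ) + 1) := by positivity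
    rw [add_re, ofReal_re]
    linarith
  have hl : Tendsto (fun n : ℕ => stableExponent α (z + ((1 / ((n : ℝ) + 1) : ℝ) : ℂ))) atTop
      (nhds (stableExponent α z)) :=
    (continuousOn_stableExponent h0 h1 z hz).tendsto.comp
      (tendsto_nhdsWithin_iff.2 ⟨hlim, Eventually.of_forall fun n => (hre n).le⟩)
  have hg : ContinuousAt (fun z : ℂ => stableExponent α 1 * z ^ (α : ℂ)) z :=
    continuousAt_const.mul (continuousAt_cpow_const hslit)
  refine tendsto_nhds_unique hl ((hg.tendsto.comp hlim).congr fun n => ?_)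
  exact (hsub _ (hre n)).symm

lemma integral_intervalIntegral_swap_of_dominated {ν : Measure ℝ} [SFinite ν] {F : ℝ → ℝ → ℂ}
    {G : ℝ → ℝ} {a b : ℝ} (hab : a ≤ b) (hF : Measurable (Function.uncurry F))
    (hG : Integrable G ν) (hbound : ∀ᵐ x ∂ν, ∀ r ∈ Set.Ioc a b, ‖F r x‖ ≤ G x) :
    ∫ x, (∫ r in a..b, F r x) ∂ν = ∫ r in a..b, (∫ x, F r x ∂ν) := by
  simp only [intervalIntegral.integral_of_le hab]
  refine integral_integral_swap (f := fun x r => F r x) ?_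
  refine Integrable.mono' (hG.comp_fst (volume.restrict (Set.Ioc a b))) ?_ ?_
  · exact (hF.comp measurable_swap).aestronglyMeasurable
  · filter_upwards [Measure.quasiMeasurePreserving_fst.ae hbound,
      Measure.quasiMeasurePreserving_snd.ae (ae_restrict_mem measurableSet_Ioc)] with p hp hp'
    exact hp _ hp'

/-- The compensated exponential `1 - exp(isx) + m isx`. -/
noncomputable def compExp (m s x : ℝ) : ℂ := 1 - cexp (s * x * I) + m * (s * x * I)

/-- The stable exponent `|s|^k (1 - i c sgn s)`. -/
noncomputable def stablePsi (k c s : ℝ) : ℂ := ((|s| ^ k : ℝ) : ℂ) * (1 - (c * Real.sign s : ℝ) * I)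

lemma neg_mul_I_cpow {α s : ℝ} (hs : s ≠ 0) (hcos : Real.cos (Real.pi * α / 2) ≠ 0) :
    (-(s * I)) ^ (α : ℂ) =
      Real.cos (Real.pi * α / 2) * stablePsi α (Real.tan (Real.pi * α / 2)) s := by
  have hR : (Real.cos (Real.pi * α / 2) : ℂ) * stablePsi α (Real.tan (Real.pi * α / 2)) s =
      ((|s| ^ α : ℝ) : ℂ) * ((Real.cos (Real.pi * α / 2) : ℂ) -
        Real.sin (Real.pi * α / 2) * Real.sign s * I) := by
    have h : (Real.cos (Real.pi * α / 2) : ℂ) * (Real.tan (Real.pi * α / 2) : ℂ) =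
        Real.sin (Real.pi * α / 2) := by
      rw [← Complex.ofReal_mul, mul_comm, Real.tan_mul_cos hcos]
    rw [stablePsi, Complex.ofReal_mul (Real.tan _)]
    linear_combination (-((|s| ^ α : ℝ) : ℂ) * Real.sign s * I) * h
  rw [hR]
  have hne : -((s : ℂ) * I) ≠ 0 := by simp [hs]
  rw [Complex.cpow_def_of_ne_zero hne]
  have habs : 0 < |s| := abs_pos.2 hs
  have hexp : cexp (Real.log |s| * α) = ((|s| ^ α : ℝ) : ℂ) := by
    rw [Real.rpow_def_of_pos habs]; push_cast; ring_nf
  rcases hs.lt_or_gt with h | h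
  · have e : -((s : ℂ) * I) = (|s| : ℝ) * I := by rw [abs_of_neg h]; push_cast; ring
    rw [e, Complex.log_ofReal_mul habs I_ne_zero, Complex.log_I, Real.sign_of_neg h, add_mul,
      Complex.exp_add, hexp, show (Real.pi : ℂ) / 2 * I * α = (Real.pi * α / 2 : ℝ) * I by
        push_cast; ring, Complex.exp_mul_I, Complex.ofReal_cos, Complex.ofReal_sin]
    push_cast
    ring
  · have e : -((s : ℂ) * I) = (|s| : ℝ) * (-I) := by rw [abs_of_pos h]; ring
    rw [e, Complex.log_ofReal_mul habs (neg_ne_zero.2 I_ne_zero), Complex.log_neg_I,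
      Real.sign_of_pos h, add_mul,
      Complex.exp_add, hexp,
      show -((Real.pi : ℂ) / 2) * I * α = ((-(Real.pi * α / 2) : ℝ) : ℂ) * I by
        push_cast; ring, Complex.exp_mul_I, Complex.ofReal_cos, Complex.ofReal_sin]
    push_cast
    rw [Complex.cos_neg, Complex.sin_neg]
    ring

lemma norm_compExp_zero_mul_le {α s x : ℝ} (hx : 0 < x) :
    ‖compExp 0 s x * ((x ^ (-1 - α) : ℝ) : ℂ)‖ ≤ (2 + |s|) * (min 1 x * x ^ (-1 - α)) := by
  have h := norm_stable_integrand_le (α := α) (z := -(s * I)) (by simp) hx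
  have e : (-(-((s : ℂ) * I) * x)) = s * x * I := by ring
  rw [e] at h
  simpa [compExp] using h

lemma exists_integral_compExp_zero {α : ℝ} (h0 : 0 < α) (h1 : α < 1) :
    ∃ A : ℝ, 0 < A ∧ ∀ s : ℝ,
      ∫ x in Set.Ioi (0 : ℝ), compExp 0 s x * ((x ^ (-1 - α) : ℝ) : ℂ) =
        (A * Real.cos (Real.pi * α / 2) : ℝ) * stablePsi α (Real.tan (Real.pi * α / 2)) s := by
  obtain ⟨A, hA, hAeq⟩ := stableExponent_one_pos h0 h1
  refine ⟨A, hA, fun s => ?_⟩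
  rcases eq_or_ne s 0 with rfl | hs
  · simp [compExp, stablePsi, h0.ne']
  · have hcos : 0 < Real.cos (Real.pi * α / 2) := by
      refine Real.cos_pos_of_mem_Ioo ⟨?_, ?_⟩ <;> nlinarith [Real.pi_pos]
    have h := stableExponent_eq h0 h1 (z := -(s * I)) (by simp) (by simp [hs])
    rw [neg_mul_I_cpow hs hcos.ne', hAeq, stableExponent] at h
    push_cast at h ⊢
    rw [mul_assoc, ← h]
    refine setIntegral_congr_fun measurableSet_Ioi fun x _ => ?_
    simp only [compExp]
    rw [show (-(-((s : ℂ) * I) * x)) = s * x * I by ring]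
    simp

lemma compExp_one_eq (s x : ℝ) :
    compExp 1 s x = ∫ r in (0 : ℝ)..1, (s * x * I) * compExp 0 (r * s) x := by
  have hd : ∀ r : ℝ, HasDerivAt (fun r : ℝ => compExp 1 (r * s) x)
      ((s * x * I) * compExp 0 (r * s) x) r := by
    intro r
    have h1 : HasDerivAt (fun r : ℝ => ((r : ℂ) * (s * x * I))) (s * x * I) r := by
      simpa using (Complex.ofRealCLM.hasDerivAt (x := r)).mul_const ((s : ℂ) * x * I)
    have h2 := (h1.cexp.const_sub 1).add h1
    unfold compExp
    convert! h2 using 1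
    · funext r
      simp only [Pi.add_apply]
      push_cast
      ring_nf
    · push_cast
      ring_nf
  have := intervalIntegral.integral_eq_sub_of_hasDerivAt (a := 0) (b := 1)
    (f := fun r : ℝ => compExp 1 (r * s) x) (fun r _ => hd r) (by
      refine Continuous.intervalIntegrable ?_ _ _
      unfold compExp
      fun_prop)
  rw [this]
  simp [compExp]

lemma exists_compensated_stable {k : ℝ} (hk : 0 < k) (hk2 : k < 2) (hk1 : k ≠ 1) :
    ∃ (m C : ℝ) (M : ℝ → ℝ), 0 < C ∧ IntegrableOn M (Set.Ioi 0) ∧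
      (∀ s x : ℝ, 0 < x → ‖compExp m s x * ((x ^ (-1 - k) : ℝ) : ℂ)‖ ≤ (2 + |s|) ^ 2 * M x) ∧
      ∀ s : ℝ, ∫ x in Set.Ioi (0 : ℝ), compExp m s x * ((x ^ (-1 - k) : ℝ) : ℂ) =
        C * stablePsi k (Real.tan (Real.pi * k / 2)) s := by
  rcases hk1.lt_or_gt with h1 | h1
  · obtain ⟨A, hA, hintegral⟩ := exists_integral_compExp_zero hk h1
    have hcos : 0 < Real.cos (Real.pi * k / 2) := by
      refine Real.cos_pos_of_mem_Ioo ⟨?_, ?_⟩ <;> nlinarith [Real.pi_pos]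
    refine ⟨0, A * Real.cos (Real.pi * k / 2), fun x => min 1 x * x ^ (-1 - k), by positivity,
      integrableOn_min_one_mul_rpow hk h1, fun s x hx => ?_, hintegral⟩
    refine (norm_compExp_zero_mul_le hx).trans ?_
    have : 0 ≤ min 1 x * x ^ (-1 - k) :=
      mul_nonneg (le_min zero_le_one hx.le) (Real.rpow_nonneg hx.le _)
    exact mul_le_mul_of_nonneg_right (by nlinarith [abs_nonneg s]) this
  · obtain ⟨A, hA, hintegral⟩ := exists_integral_compExp_zero (α := k - 1) (by linarith) (by linarith)
    have hM := integrableOn_min_one_mul_rpow (α := k - 1) (by linarith) (by linarith)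
    have hcos : Real.cos (Real.pi * k / 2) < 0 := by
      refine Real.cos_neg_of_pi_div_two_lt_of_lt ?_ ?_ <;> nlinarith [Real.pi_pos]
    have hsin : 0 < Real.sin (Real.pi * k / 2) := by
      refine Real.sin_pos_of_pos_of_lt_pi ?_ ?_ <;> nlinarith [Real.pi_pos]
    have hrep : ∀ s x : ℝ, 0 < x → compExp 1 s x * ((x ^ (-1 - k) : ℝ) : ℂ) =
        ∫ r in (0 : ℝ)..1, (s * I) * (compExp 0 (r * s) x * ((x ^ (-1 - (k - 1)) : ℝ) : ℂ)) := by
      intro s x hx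
      rw [compExp_one_eq, ← intervalIntegral.integral_mul_const]
      refine intervalIntegral.integral_congr fun r _ => ?_
      rw [show -1 - (k - 1) = 1 + (-1 - k) by ring, Real.rpow_add hx, Real.rpow_one]
      push_cast
      ring
    have hb : ∀ s x : ℝ, 0 < x → ∀ r ∈ Set.Ioc (0 : ℝ) 1,
        ‖(s * I) * (compExp 0 (r * s) x * ((x ^ (-1 - (k - 1)) : ℝ) : ℂ))‖ ≤
          (2 + |s|) ^ 2 * (min 1 x * x ^ (-1 - (k - 1))) := by
      intro s x hx r hr
      have h0 : 0 ≤ min 1 x * x ^ (-1 - (k - 1)) :=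
        mul_nonneg (le_min zero_le_one hx.le) (Real.rpow_nonneg hx.le _)
      rw [norm_mul, norm_mul, Complex.norm_real, Complex.norm_I, mul_one, Real.norm_eq_abs]
      have hrs : |r * s| ≤ |s| := by
        rw [abs_mul, abs_of_pos hr.1]
        nlinarith [abs_nonneg s, hr.2]
      calc |s| * _ ≤ |s| * ((2 + |r * s|) * (min 1 x * x ^ (-1 - (k - 1)))) :=
            mul_le_mul_of_nonneg_left (norm_compExp_zero_mul_le hx) (abs_nonneg s)
        _ ≤ (2 + |s|) * ((2 + |s|) * (min 1 x * x ^ (-1 - (k - 1)))) := by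
            gcongr
            linarith
        _ = _ := by ring
    refine ⟨1, A * (-Real.cos (Real.pi * k / 2)) / k, fun x => min 1 x * x ^ (-1 - (k - 1)), by
      have := neg_pos.2 hcos; positivity, hM, fun s x hx => ?_, fun s => ?_⟩
    · rw [hrep s x hx]
      have := intervalIntegral.norm_integral_le_of_norm_le_const (a := 0) (b := 1)
        (f := fun r : ℝ => (s * I) * (compExp 0 (r * s) x * ((x ^ (-1 - (k - 1)) : ℝ) : ℂ)))
        (C := (2 + |s|) ^ 2 * (min 1 x * x ^ (-1 - (k - 1)))) (by
          rw [Set.uIoc_of_le zero_le_one]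
          exact hb s x hx)
      simpa using this
    · rw [setIntegral_congr_fun measurableSet_Ioi (fun x hx => hrep s x hx),
        integral_intervalIntegral_swap_of_dominated zero_le_one ?_
          (hM.const_mul ((2 + |s|) ^ 2)) ?_]
      · simp only [integral_const_mul, hintegral]
        have hcosk : Real.cos (Real.pi * (k - 1) / 2) = Real.sin (Real.pi * k / 2) := by
          rw [← Real.cos_sub_pi_div_two]; ring_nf
        have hsink : Real.sin (Real.pi * (k - 1) / 2) = -Real.cos (Real.pi * k / 2) := by
          rw [← Real.sin_sub_pi_div_two]; ring_nf
        have hpsi : ∀ r ∈ Set.uIcc (0 : ℝ) 1,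
            (s * I) * ((A * Real.cos (Real.pi * (k - 1) / 2) : ℝ) *
            stablePsi (k - 1) (Real.tan (Real.pi * (k - 1) / 2)) (r * s)) =
            ((r ^ (k - 1) : ℝ) : ℂ) * ((s * I) * ((A * Real.cos (Real.pi * (k - 1) / 2) : ℝ) *
              stablePsi (k - 1) (Real.tan (Real.pi * (k - 1) / 2)) s)) := by
          intro r hr
          rw [Set.uIcc_of_le zero_le_one] at hr
          rcases hr.1.eq_or_lt with h | h
          · subst h
            simp [stablePsi, Real.zero_rpow (by linarith : k - 1 ≠ 0)]
          · have hsg : Real.sign (r * s) = Real.sign s := by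
              rcases lt_trichotomy s 0 with h' | h' | h'
              · rw [Real.sign_of_neg h', Real.sign_of_neg (mul_neg_of_pos_of_neg h h')]
              · simp [h']
              · rw [Real.sign_of_pos h', Real.sign_of_pos (mul_pos h h')]
            rw [stablePsi, stablePsi, hsg, abs_mul, abs_of_pos h,
              Real.mul_rpow h.le (abs_nonneg s)]
            push_cast
            ring
        rw [intervalIntegral.integral_congr hpsi, intervalIntegral.integral_mul_const,
          intervalIntegral.integral_ofReal, integral_rpow (Or.inl (by linarith))]
        have htan : Real.tan (Real.pi * (k - 1) / 2) =
            -Real.cos (Real.pi * k / 2) / Real.sin (Real.pi * k / 2) := by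
          rw [Real.tan_eq_sin_div_cos, hcosk, hsink]
        have hs' : ((|s| ^ k : ℝ) : ℂ) = ((|s| ^ (k - 1) : ℝ) : ℂ) * |s| := by
          rcases eq_or_ne s 0 with rfl | hs
          · simp [hk.ne']
          · rw [← Complex.ofReal_mul, ← Real.rpow_add_one (abs_ne_zero.2 hs)]
            ring_nf
        rcases eq_or_ne s 0 with rfl | hs
        · simp [stablePsi, hk.ne']
        have hsgn : (s : ℂ) = |s| * Real.sign s ∧ (Real.sign s : ℂ) * Real.sign s = 1 := by
          rcases hs.lt_or_gt with h | h
          · rw [Real.sign_of_neg h, abs_of_neg h]; push_cast; constructor <;> ring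
          · rw [Real.sign_of_pos h, abs_of_pos h]; push_cast; constructor <;> ring
        rw [stablePsi, stablePsi, htan, hcosk, Real.tan_eq_sin_div_cos, hs']
        have hc' : (Real.cos (Real.pi * k / 2) : ℂ) ≠ 0 := by exact_mod_cast hcos.ne
        have hs'' : (Real.sin (Real.pi * k / 2) : ℂ) ≠ 0 := by exact_mod_cast hsin.ne'
        have hk' : (k : ℂ) ≠ 0 := by exact_mod_cast hk.ne'
        have h1k : ((1 : ℝ) ^ (k - 1 + 1) - 0 ^ (k - 1 + 1)) / (k - 1 + 1) = 1 / k := by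
          rw [Real.one_rpow, sub_add_cancel, Real.zero_rpow hk.ne']; simp
        rw [h1k]
        generalize ((|s| ^ (k - 1) : ℝ) : ℂ) = P
        generalize hsi : Real.sin (Real.pi * k / 2) = Si at *
        generalize hco : Real.cos (Real.pi * k / 2) = Co at *
        obtain ⟨e1, e2⟩ := hsgn
        generalize Real.sign s = σ at *
        generalize |s| = as at *
        rw [e1]
        push_cast
        field_simp
        linear_combination (as : ℂ) * A * P * Co * (I ^ 2 * e2 + I_sq)
      · unfold compExp
        fun_prop
      · filter_upwards [ae_restrict_mem measurableSet_Ioi] with x hx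
        exact hb s x hx

/-- The difference between the average of `ψ` over `[s - 1, s + 1]` and its value at `s`. -/
noncomputable def avgDiff (ψ : ℝ → ℂ) (s : ℝ) : ℂ :=
  (1 / 2 : ℂ) * (∫ r in (-1 : ℝ)..1, ψ (s + r)) - ψ s

lemma integral_cexp_mul_I_eq_sinc (x : ℝ) :
    ∫ r in (-1 : ℝ)..1, cexp (r * x * I) = 2 * (Real.sinc x : ℂ) := by
  rcases eq_or_ne x 0 with rfl | hx
  · norm_num
  · have hx' : (x : ℂ) * I ≠ 0 := by simp [hx]
    have h := integral_exp_mul_complex (a := -1) (b := 1) hx'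
    have e : ∀ r : ℝ, cexp (r * x * I) = cexp (x * I * r) := fun r => by ring_nf
    simp only [e]
    rw [h, Real.sinc_of_ne_zero hx, div_eq_iff hx']
    have hxc : (x : ℂ) ≠ 0 := by exact_mod_cast hx
    have e1 : cexp (x * I * (1 : ℝ)) = Complex.cos x + Complex.sin x * I := by
      rw [← Complex.exp_mul_I]; simp
    have e2 : cexp (x * I * (-1 : ℝ)) = Complex.cos x - Complex.sin x * I := by
      have := Complex.exp_mul_I (-(x : ℂ))
      rw [Complex.cos_neg, Complex.sin_neg] at this
      rw [← show -(x : ℂ) * I = x * I * (-1 : ℝ) by simp, this]; ring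
    rw [e1, e2]
    push_cast
    field_simp
    ring

lemma avgDiff_compExp (m s x : ℝ) :
    avgDiff (fun r => compExp m r x) s = cexp (s * x * I) * (1 - Real.sinc x : ℝ) := by
  have e : ∀ r : ℝ, compExp m (s + r) x =
      (1 + m * s * x * I) + (m * x * I) * (r : ℂ) - cexp (s * x * I) * cexp (r * x * I) := by
    intro r
    rw [compExp, ← Complex.exp_add]
    push_cast
    ring_nf
  have i1 : ∀ c : ℂ, IntervalIntegrable (fun r : ℝ => c * (r : ℂ)) volume (-1) 1 := fun c =>
    Continuous.intervalIntegrable (by fun_prop) _ _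
  have i2 : ∀ c : ℂ, IntervalIntegrable (fun r : ℝ => c * cexp (r * x * I)) volume (-1) 1 :=
    fun c => Continuous.intervalIntegrable (by fun_prop) _ _
  rw [avgDiff]
  simp only [e]
  rw [intervalIntegral.integral_sub (intervalIntegrable_const.add (i1 _)) (i2 _),
    intervalIntegral.integral_add intervalIntegrable_const (i1 _),
    intervalIntegral.integral_const_mul, intervalIntegral.integral_const_mul,
    integral_cexp_mul_I_eq_sinc, intervalIntegral.integral_const, intervalIntegral.integral_ofReal]
  simp [compExp]
  ring

/-- The measure with density `(1 - sinc x) g x` with respect to `ν`. -/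
noncomputable def sincMeasure (ν : Measure ℝ) (g : ℝ → ℝ) : Measure ℝ :=
  ν.withDensity fun x => ENNReal.ofReal ((1 - Real.sinc x) * g x)

lemma one_sub_sinc_nonneg (x : ℝ) : 0 ≤ 1 - Real.sinc x := sub_nonneg.2 (Real.sinc_le_one x)

lemma integral_sincMeasure {E : Type*} [NormedAddCommGroup E] [NormedSpace ℝ E]
    {ν : Measure ℝ} {g : ℝ → ℝ} (hg : Measurable g) (hg0 : ∀ᵐ x ∂ν, 0 ≤ g x) (f : ℝ → E) :
    ∫ x, f x ∂(sincMeasure ν g) = ∫ x, ((1 - Real.sinc x) * g x) • f x ∂ν := by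
  have := Real.continuous_sinc.measurable
  rw [sincMeasure, integral_withDensity_eq_integral_toReal_smul (by fun_prop) (by simp)]
  refine integral_congr_ae ?_
  filter_upwards [hg0] with x hx
  rw [ENNReal.toReal_ofReal (mul_nonneg (one_sub_sinc_nonneg x) hx)]

section

variable {ν : Measure ℝ} {g M : ℝ → ℝ} {m : ℝ}

lemma norm_one_sub_sinc_mul_le (x b G : ℝ)
    (hb : ∀ s : ℝ, ‖compExp m s x * (b : ℂ)‖ ≤ (2 + |s|) ^ 2 * G) :
    ‖(1 - Real.sinc x) * b‖ ≤ 9 * G := by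
  have h0 : compExp m 0 x = 0 := by simp [compExp]
  have h := avgDiff_compExp m 0 x
  rw [avgDiff, h0] at h
  simp only [zero_add, sub_zero, ofReal_zero, zero_mul, Complex.exp_zero, one_mul] at h
  have hG : 0 ≤ G := by
    have := (norm_nonneg _).trans (hb 0)
    simp only [abs_zero, add_zero] at this
    linarith
  have hI := intervalIntegral.norm_integral_le_of_norm_le_const (a := -1) (b := 1)
    (f := fun r : ℝ => compExp m r x * (b : ℂ)) (C := 9 * G) (by
      intro r hr
      rw [Set.uIoc_of_le (by norm_num)] at hr
      have hr' : |r| ≤ 1 := abs_le.2 ⟨hr.1.le, hr.2⟩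
      refine (hb r).trans (mul_le_mul_of_nonneg_right ?_ hG)
      nlinarith [abs_nonneg r])
  rw [intervalIntegral.integral_mul_const] at hI
  rw [← Complex.norm_real, Complex.ofReal_mul, ← h, mul_assoc, norm_mul]
  norm_num at hI ⊢
  linarith

lemma integrable_one_sub_sinc_mul (hg : Measurable g) (hM : Integrable M ν)
    (hb : ∀ᵐ x ∂ν, ∀ s : ℝ, ‖compExp m s x * ((g x : ℝ) : ℂ)‖ ≤ (2 + |s|) ^ 2 * M x) :
    Integrable (fun x => (1 - Real.sinc x) * g x) ν := by
  have := Real.continuous_sinc.measurable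
  refine (hM.const_mul 9).mono' (by fun_prop) ?_
  filter_upwards [hb] with x hx
  exact norm_one_sub_sinc_mul_le x (g x) (M x) hx

lemma isFiniteMeasure_sincMeasure (hg : Measurable g) (hM : Integrable M ν)
    (hb : ∀ᵐ x ∂ν, ∀ s : ℝ, ‖compExp m s x * ((g x : ℝ) : ℂ)‖ ≤ (2 + |s|) ^ 2 * M x) :
    IsFiniteMeasure (sincMeasure ν g) :=
  isFiniteMeasure_withDensity_ofReal (integrable_one_sub_sinc_mul hg hM hb).2

lemma charFun_sincMeasure [SFinite ν] (hg : Measurable g) (hg0 : ∀ᵐ x ∂ν, 0 ≤ g x)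
    (hM : Integrable M ν)
    (hb : ∀ᵐ x ∂ν, ∀ s : ℝ, ‖compExp m s x * ((g x : ℝ) : ℂ)‖ ≤ (2 + |s|) ^ 2 * M x) (s : ℝ) :
    charFun (sincMeasure ν g) s =
      avgDiff (fun s => ∫ x, compExp m s x * ((g x : ℝ) : ℂ) ∂ν) s := by
  have hmeas : Measurable (Function.uncurry fun r x : ℝ =>
      compExp m (s + r) x * ((g x : ℝ) : ℂ)) := by
    unfold compExp
    fun_prop
  have hmeas1 : ∀ s, Measurable fun x : ℝ => compExp m s x * ((g x : ℝ) : ℂ) := by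
    intro s
    unfold compExp
    fun_prop
  have hintegral : ∀ s, Integrable (fun x : ℝ => compExp m s x * ((g x : ℝ) : ℂ)) ν := by
    intro s
    refine (hM.const_mul ((2 + |s|) ^ 2)).mono' (hmeas1 s).aestronglyMeasurable ?_
    filter_upwards [hb] with x hx using hx s
  have hbd : ∀ᵐ x ∂ν, ∀ r ∈ Set.Ioc (-1 : ℝ) 1,
      ‖compExp m (s + r) x * ((g x : ℝ) : ℂ)‖ ≤ (3 + |s|) ^ 2 * M x := by
    filter_upwards [hb] with x hx r hr
    have hr' : |r| ≤ 1 := abs_le.2 ⟨hr.1.le, hr.2⟩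
    have hM0 : 0 ≤ M x := by
      have := (norm_nonneg _).trans (hx 0)
      simp only [abs_zero, add_zero] at this
      linarith
    refine (hx _).trans (mul_le_mul_of_nonneg_right ?_ hM0)
    have := abs_add_le s r
    exact pow_le_pow_left₀ (by positivity) (by linarith) 2
  have hsw := integral_intervalIntegral_swap_of_dominated (by norm_num : (-1 : ℝ) ≤ 1) hmeas
    (hM.const_mul ((3 + |s|) ^ 2)) hbd
  have hI : Integrable (fun x => ∫ r in (-1 : ℝ)..1, compExp m (s + r) x * ((g x : ℝ) : ℂ)) ν := by
    refine (hM.const_mul (2 * (3 + |s|) ^ 2)).mono' ?_ ?_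
    · simp only [intervalIntegral.integral_of_le (by norm_num : (-1 : ℝ) ≤ 1)]
      exact (StronglyMeasurable.integral_prod_left'
        (μ := volume.restrict (Set.Ioc (-1 : ℝ) 1)) hmeas.stronglyMeasurable).aestronglyMeasurable
    · filter_upwards [hbd] with x hx
      have := intervalIntegral.norm_integral_le_of_norm_le_const (a := -1) (b := 1)
        (f := fun r : ℝ => compExp m (s + r) x * ((g x : ℝ) : ℂ)) (by
          rw [Set.uIoc_of_le (by norm_num)]; exact hx)
      norm_num at this ⊢
      linarith
  rw [charFun_apply_real, integral_sincMeasure hg hg0, avgDiff, ← hsw, ← integral_const_mul,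
    ← integral_sub (hI.const_mul _) (hintegral s)]
  refine integral_congr_ae (Eventually.of_forall fun x => ?_)
  have h := avgDiff_compExp m s x
  rw [avgDiff] at h
  simp only [intervalIntegral.integral_mul_const]
  rw [Complex.real_smul, Complex.ofReal_mul]
  linear_combination (-(g x : ℂ)) * h

end

lemma stablePsi_neg (k c s : ℝ) : stablePsi k c (-s) = stablePsi k (-c) s := by
  simp [stablePsi, Real.sign_neg]

lemma measurable_stablePsi (k c : ℝ) : Measurable (stablePsi k c) := by
  have hs : Measurable Real.sign :=
    Measurable.ite measurableSet_Iio measurable_const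
      (Measurable.ite measurableSet_Ioi measurable_const measurable_const)
  unfold stablePsi
  fun_prop

lemma norm_stablePsi_le {k : ℝ} (hk : 0 ≤ k) (c : ℝ) {s L : ℝ} (hs : |s| ≤ L) :
    ‖stablePsi k c s‖ ≤ L ^ k * (1 + |c|) := by
  rw [stablePsi, norm_mul, Complex.norm_real,
    Real.norm_of_nonneg (Real.rpow_nonneg (abs_nonneg s) k)]
  refine mul_le_mul (Real.rpow_le_rpow (abs_nonneg s) hs hk) ?_ (norm_nonneg _)
    (Real.rpow_nonneg ((abs_nonneg s).trans hs) k)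
  refine (norm_sub_le _ _).trans ?_
  have : |Real.sign s| ≤ 1 := by
    rcases Real.sign_apply_eq s with h | h | h <;> rw [h] <;> norm_num
  rw [norm_mul, Complex.norm_real, Complex.norm_I, norm_one, mul_one, Real.norm_eq_abs, abs_mul]
  nlinarith [abs_nonneg c]

lemma intervalIntegrable_stablePsi_add {k : ℝ} (hk : 0 ≤ k) (c s : ℝ) :
    IntervalIntegrable (fun r => stablePsi k c (s + r)) volume (-1) 1 := by
  rw [intervalIntegrable_iff_integrableOn_Ioc_of_le (by norm_num)]
  refine Measure.integrableOn_of_bounded (M := (|s| + 1) ^ k * (1 + |c|)) (by simp)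
    ((measurable_stablePsi k c).comp (measurable_const_add s)).aestronglyMeasurable ?_
  filter_upwards [ae_restrict_mem measurableSet_Ioc] with r hr
  refine norm_stablePsi_le hk c ((abs_add_le s r).trans ?_)
  have : |r| ≤ 1 := abs_le.2 ⟨hr.1.le, hr.2⟩
  linarith

lemma avgDiff_neg (ψ : ℝ → ℂ) (s : ℝ) : avgDiff ψ (-s) = avgDiff (fun r => ψ (-r)) s := by
  have h := intervalIntegral.integral_comp_neg (a := -1) (b := 1) fun r => ψ (-s + r)
  rw [neg_neg] at h
  rw [avgDiff, avgDiff, ← h]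
  simp only [neg_add]

lemma charFun_map_neg (ρ : Measure ℝ) (s : ℝ) :
    charFun (ρ.map fun x => -x) s = charFun ρ (-s) := by
  have h := charFun_map_mul (μ := ρ) (-1) s
  simpa using h

/-- The `sinc`-weighted stable Lévy measure on the positive half-line. -/
noncomputable def stableSincMeasure (k : ℝ) : Measure ℝ :=
  sincMeasure (volume.restrict (Set.Ioi 0)) fun x => x ^ (-1 - k)

lemma exists_charFun_stableSincMeasure {k : ℝ} (hk : 0 < k) (hk2 : k < 2) (hk1 : k ≠ 1) :
    IsFiniteMeasure (stableSincMeasure k) ∧ ∃ C : ℝ, 0 < C ∧ ∀ s,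
      charFun (stableSincMeasure k) s =
        avgDiff (fun s => C * stablePsi k (Real.tan (Real.pi * k / 2)) s) s := by
  obtain ⟨m, C, M, hC, hM, hb, hintegral⟩ := exists_compensated_stable hk hk2 hk1
  have hg : Measurable fun x : ℝ => x ^ (-1 - k) := by fun_prop
  have hb' : ∀ᵐ x ∂(volume.restrict (Set.Ioi (0 : ℝ))), ∀ s : ℝ,
      ‖compExp m s x * ((x ^ (-1 - k) : ℝ) : ℂ)‖ ≤ (2 + |s|) ^ 2 * M x := by
    filter_upwards [ae_restrict_mem measurableSet_Ioi] with x hx s using hb s x hx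
  have hg0 : ∀ᵐ x ∂(volume.restrict (Set.Ioi (0 : ℝ))), 0 ≤ x ^ (-1 - k) := by
    filter_upwards [ae_restrict_mem measurableSet_Ioi] with x hx
    exact Real.rpow_nonneg (le_of_lt hx) _
  refine ⟨isFiniteMeasure_sincMeasure hg hM hb', C, hC, fun s => ?_⟩
  rw [stableSincMeasure, charFun_sincMeasure hg hg0 hM hb']
  simp only [hintegral]

lemma tan_pi_mul_div_two_ne_zero {k : ℝ} (hk : 0 < k) (hk2 : k < 2) (hk1 : k ≠ 1) :
    Real.tan (Real.pi * k / 2) ≠ 0 := by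
  have hsin : 0 < Real.sin (Real.pi * k / 2) := by
    refine Real.sin_pos_of_pos_of_lt_pi ?_ ?_ <;> nlinarith [Real.pi_pos]
  have hcos : Real.cos (Real.pi * k / 2) ≠ 0 := by
    rcases hk1.lt_or_gt with h | h
    · refine (Real.cos_pos_of_mem_Ioo ⟨?_, ?_⟩).ne' <;> nlinarith [Real.pi_pos]
    · refine (Real.cos_neg_of_pi_div_two_lt_of_lt ?_ ?_).ne <;> nlinarith [Real.pi_pos]
  rw [Real.tan_eq_sin_div_cos]
  exact div_ne_zero hsin.ne' hcos

lemma exists_combination_charFun_eq_avgDiff_stablePsi {k : ℝ} (hk : 0 < k) (hk2 : k < 2)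
    (hk1 : k ≠ 1) :
    IsFiniteMeasure (stableSincMeasure k) ∧ ∃ C : ℝ, 0 < C ∧ ∀ c s : ℝ,
      (((1 + c / Real.tan (Real.pi * k / 2)) / (2 * C) : ℝ) : ℂ) *
          charFun (stableSincMeasure k) s +
        (((1 - c / Real.tan (Real.pi * k / 2)) / (2 * C) : ℝ) : ℂ) *
          charFun ((stableSincMeasure k).map fun x => -x) s = avgDiff (stablePsi k c) s := by
  obtain ⟨hfin, C, hC, hchar⟩ := exists_charFun_stableSincMeasure hk hk2 hk1
  refine ⟨hfin, C, hC, fun c s => ?_⟩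
  have hT := tan_pi_mul_div_two_ne_zero hk hk2 hk1
  set T := Real.tan (Real.pi * k / 2) with hTdef
  have hTc : (T : ℂ) ≠ 0 := by exact_mod_cast hT
  have hCc : (C : ℂ) ≠ 0 := by exact_mod_cast hC.ne'
  rw [charFun_map_neg, hchar, hchar, avgDiff_neg]
  simp only [stablePsi_neg]
  have hcomb : ∀ r, stablePsi k c r = (((1 + c / T) / 2 : ℝ) : ℂ) * stablePsi k T r +
      (((1 - c / T) / 2 : ℝ) : ℂ) * stablePsi k (-T) r := by
    intro r
    simp only [stablePsi]
    push_cast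
    field_simp
    ring
  simp only [avgDiff, hcomb]
  rw [intervalIntegral.integral_add ((intervalIntegrable_stablePsi_add hk.le T s).const_mul _)
    ((intervalIntegrable_stablePsi_add hk.le (-T) s).const_mul _)]
  simp only [intervalIntegral.integral_const_mul]
  push_cast
  field_simp
  ring

lemma one_sub_cos_add_le (a b : ℝ) :
    1 - Real.cos (a + b) ≤ 2 * (1 - Real.cos a) + 2 * (1 - Real.cos b) := by
  rw [Real.cos_add]
  nlinarith [Real.cos_le_one a, Real.cos_le_one b, Real.sin_sq_add_cos_sq a,
    Real.sin_sq_add_cos_sq b, sq_nonneg (Real.sin a - Real.sin b),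
    sq_nonneg (1 - Real.cos a), sq_nonneg (1 - Real.cos b),
    mul_nonneg (sub_nonneg.2 (Real.cos_le_one a)) (sub_nonneg.2 (Real.cos_le_one b))]

section

variable (μ : Measure ℝ) [IsProbabilityMeasure μ]

lemma integrable_one_sub_cos (t : ℝ) : Integrable (fun x => 1 - Real.cos (t * x)) μ := by
  refine Integrable.of_bound (by fun_prop) 2 (Eventually.of_forall fun x => ?_)
  rw [Real.norm_eq_abs, abs_le]
  constructor <;> linarith [Real.cos_le_one (t * x), Real.neg_one_le_cos (t * x)]

lemma one_sub_re_charFun (t : ℝ) :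
    1 - (charFun μ t).re = ∫ x, (1 - Real.cos (t * x)) ∂μ := by
  have hc : Integrable (fun x => Real.cos (t * x)) μ := by
    refine Integrable.of_bound (by fun_prop) 1 (Eventually.of_forall fun x => ?_)
    exact Real.abs_cos_le_one _
  rw [integral_sub (integrable_const 1) hc, charFun_apply_real]
  have h := integral_re (𝕜 := ℂ) (integrable_cexp_mul_I t μ)
  simp only [RCLike.re_to_complex] at h
  rw [← h]
  simp [← Complex.ofReal_mul, Complex.exp_ofReal_mul_I_re]

lemma one_sub_re_charFun_nonneg (t : ℝ) : 0 ≤ 1 - (charFun μ t).re := by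
  rw [one_sub_re_charFun]
  exact integral_nonneg fun x => sub_nonneg.2 (Real.cos_le_one _)

lemma one_sub_re_charFun_add_le (s t : ℝ) : 1 - (charFun μ (s + t)).re ≤
    2 * (1 - (charFun μ s).re) + 2 * (1 - (charFun μ t).re) := by
  simp only [one_sub_re_charFun]
  rw [← integral_const_mul, ← integral_const_mul, ← integral_add
    ((integrable_one_sub_cos μ s).const_mul 2) ((integrable_one_sub_cos μ t).const_mul 2)]
  refine integral_mono (integrable_one_sub_cos μ _)
    (((integrable_one_sub_cos μ s).const_mul 2).add ((integrable_one_sub_cos μ t).const_mul 2))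
    fun x => ?_
  simp only [add_mul]
  exact one_sub_cos_add_le _ _

end

/-- A pointwise bounded family of continuous even functions with a relaxed subadditivity
property is uniformly bounded on bounded sets. -/
lemma exists_uniform_bound_of_quasi_subadditive {h : ℕ → ℝ → ℝ} (hc : ∀ n, Continuous (h n))
    (heven : ∀ n s, h n (-s) = h n s) (hadd : ∀ n s t, h n (s + t) ≤ 2 * h n s + 2 * h n t)
    (hbdd : ∀ s, ∃ B : ℝ, ∀ n, h n s ≤ B) (L : ℝ) :
    ∃ B : ℝ, ∀ n s, |s| ≤ L → h n s ≤ B := by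
  have hclosed : ∀ N : ℕ, IsClosed {s | ∀ n, h n s ≤ N} := by
    intro N
    simp only [Set.ofPred_forall]
    exact isClosed_iInter fun n => isClosed_le (hc n) continuous_const
  have hunion : ⋃ N : ℕ, {s | ∀ n, h n s ≤ N} = Set.univ := by
    refine Set.eq_univ_of_forall fun s => ?_
    obtain ⟨B, hB⟩ := hbdd s
    obtain ⟨N, hN⟩ := exists_nat_ge B
    exact Set.mem_iUnion.2 ⟨N, fun n => (hB n).trans hN⟩
  obtain ⟨N, s₀, hs₀⟩ := nonempty_interior_of_iUnion_of_closed hclosed hunion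
  obtain ⟨ε, hε, hball⟩ := Metric.mem_nhds_iff.1 (mem_interior_iff_mem_nhds.1 hs₀)
  have hsmall : ∀ n s, |s| < ε → h n s ≤ 4 * N := by
    intro n s hs
    have h1 : h n (s₀ + s) ≤ N := hball (by simpa [Metric.mem_ball, Real.dist_eq] using hs) n
    have h2 : h n s₀ ≤ N := hball (Metric.mem_ball_self hε) n
    have h3 := hadd n (s₀ + s) (-s₀)
    rw [heven, add_neg_cancel_comm] at h3
    linarith
  have hdouble : ∀ j : ℕ, ∃ B : ℝ, ∀ n s, |s| < 2 ^ j * ε → h n s ≤ B := by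
    intro j
    induction j with
    | zero => exact ⟨4 * N, fun n s hs => hsmall n s (by simpa using hs)⟩
    | succ j ih =>
      obtain ⟨B, hB⟩ := ih
      refine ⟨4 * B, fun n s hs => ?_⟩
      have h1 := hadd n (s / 2) (s / 2)
      have h2 := hB n (s / 2) (by
        rw [abs_div, abs_two, div_lt_iff₀ two_pos]
        rw [pow_succ] at hs
        linarith)
      rw [add_halves] at h1
      linarith
  obtain ⟨j, hj⟩ := pow_unbounded_of_one_lt (L / ε) one_lt_two
  obtain ⟨B, hB⟩ := hdouble j
  exact ⟨B, fun n s hs => hB n s (hs.trans_lt ((div_lt_iff₀ hε).1 hj))⟩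

/-- Regular variation of `1 - U` at zero with index `k`, and `V / (1 - U) → c`. -/
structure RegularlyVaryingAtZero (μ : Measure ℝ) (k c : ℝ) : Prop where
  pos : ∀ᶠ t in nhdsWithin (0 : ℝ) (Set.Ioi 0), 0 < 1 - (charFun μ t).re
  re : ∀ l : ℝ, 0 < l →
    Tendsto (fun t : ℝ => (1 - (charFun μ (l * t)).re) / (1 - (charFun μ t).re))
      (nhdsWithin 0 (Set.Ioi 0)) (nhds (l ^ k))
  im : Tendsto (fun t : ℝ => (charFun μ t).im / (1 - (charFun μ t).re))
    (nhdsWithin 0 (Set.Ioi 0)) (nhds c)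

namespace RegularlyVaryingAtZero

lemma map_neg {μ : Measure ℝ} {k c : ℝ} (h : RegularlyVaryingAtZero μ k c) :
    RegularlyVaryingAtZero (μ.map fun x => -x) k (-c) where
  pos := by simpa [charFun_map_neg, charFun_neg] using h.pos
  re := by simpa [charFun_map_neg, charFun_neg] using h.re
  im := by
    have := h.im.neg
    simpa [charFun_map_neg, charFun_neg, neg_div] using this

variable {μ : Measure ℝ} [IsProbabilityMeasure μ] {k c : ℝ}

lemma tendsto_re (h : RegularlyVaryingAtZero μ k c) (hk : 0 < k) (s : ℝ) :
    Tendsto (fun t : ℝ => (1 - (charFun μ (s * t)).re) / (1 - (charFun μ t).re))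
      (nhdsWithin 0 (Set.Ioi 0)) (nhds (|s| ^ k)) := by
  rcases lt_trichotomy s 0 with hs | rfl | hs
  · have := h.re (-s) (neg_pos.2 hs)
    simpa [charFun_neg, abs_of_neg hs] using this
  · simp [Real.zero_rpow hk.ne']
  · simpa [abs_of_pos hs] using h.re s hs

lemma tendsto_im (h : RegularlyVaryingAtZero μ k c) (s : ℝ) :
    Tendsto (fun t : ℝ => (charFun μ (s * t)).im / (1 - (charFun μ t).re))
      (nhdsWithin 0 (Set.Ioi 0)) (nhds (|s| ^ k * (c * Real.sign s))) := by
  have key : ∀ l : ℝ, 0 < l →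
      Tendsto (fun t : ℝ => (charFun μ (l * t)).im / (1 - (charFun μ t).re))
        (nhdsWithin 0 (Set.Ioi 0)) (nhds (l ^ k * c)) := by
    intro l hl
    have hl' : Tendsto (fun t : ℝ => l * t) (nhdsWithin 0 (Set.Ioi 0))
        (nhdsWithin 0 (Set.Ioi 0)) := by
      refine tendsto_nhdsWithin_of_tendsto_nhds_of_eventually_within _ ?_ ?_
      · have : Tendsto (fun t : ℝ => l * t) (nhds 0) (nhds (l * 0)) :=
          (continuous_const_mul l).tendsto 0
        rw [mul_zero] at this
        exact this.mono_left nhdsWithin_le_nhds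
      · filter_upwards [self_mem_nhdsWithin] with t ht using mul_pos hl ht
    refine ((h.re l hl).mul (h.im.comp hl')).congr' ?_
    filter_upwards [hl'.eventually h.pos] with t ht
    simp only [Function.comp_apply]
    field_simp
  rcases lt_trichotomy s 0 with hs | rfl | hs
  · have := (key (-s) (neg_pos.2 hs)).neg
    simpa [charFun_neg, abs_of_neg hs, Real.sign_of_neg hs, neg_div] using this
  · simp
  · simpa [abs_of_pos hs, Real.sign_of_pos hs] using key s hs

lemma exists_abs_im_le (h : RegularlyVaryingAtZero μ k c) :
    ∃ δ > (0 : ℝ), ∀ u : ℝ, |u| < δ →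
      |(charFun μ u).im| ≤ (|c| + 1) * (1 - (charFun μ u).re) := by
  have hev : ∀ᶠ t in nhdsWithin (0 : ℝ) (Set.Ioi 0),
      |(charFun μ t).im| ≤ (|c| + 1) * (1 - (charFun μ t).re) := by
    filter_upwards [h.pos, h.im.abs.eventually_lt_const (lt_add_one |c|)] with t h1 h2
    rw [abs_div, abs_of_pos h1, div_lt_iff₀ h1] at h2
    exact h2.le
  obtain ⟨δ, hδ, hball⟩ := mem_nhdsGT_iff_exists_Ioo_subset.1 hev
  refine ⟨δ, hδ, fun u hu => ?_⟩
  rcases lt_trichotomy u 0 with h0 | rfl | h0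
  · have := hball (show -u ∈ Set.Ioo 0 δ from ⟨neg_pos.2 h0, by rwa [abs_of_neg h0] at hu⟩)
    simpa [charFun_neg] using this
  · simp
  · exact hball ⟨h0, by rwa [abs_of_pos h0] at hu⟩

lemma tendsto_one_sub_charFun (h : RegularlyVaryingAtZero μ k c) (hk : 0 < k) (s : ℝ) :
    Tendsto (fun t : ℝ => (1 - charFun μ (s * t)) * ((1 - (charFun μ t).re)⁻¹ : ℝ))
      (nhdsWithin 0 (Set.Ioi 0)) (nhds (stablePsi k c s)) := by
  have h1 := (Complex.continuous_ofReal.tendsto _).comp (h.tendsto_re hk s)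
  have h2 := ((Complex.continuous_ofReal.tendsto _).comp (h.tendsto_im s)).mul_const I
  have h3 := h1.sub h2
  have e : ((|s| ^ k : ℝ) : ℂ) - ((|s| ^ k * (c * Real.sign s) : ℝ) : ℂ) * I =
      stablePsi k c s := by
    rw [stablePsi]
    push_cast
    ring
  rw [e] at h3
  refine h3.congr fun t => ?_
  simp only [Function.comp_apply]
  conv_rhs => rw [← Complex.re_add_im (charFun μ (s * t))]
  push_cast
  ring

lemma exists_norm_le (h : RegularlyVaryingAtZero μ k c) (hk : 0 < k) {t : ℕ → ℝ}
    (ht : Tendsto t atTop (nhdsWithin 0 (Set.Ioi 0))) (L : ℝ) :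
    ∃ B : ℝ, ∀ᶠ n in atTop, ∀ s, |s| ≤ L →
      ‖(1 - charFun μ (s * t n)) * ((1 - (charFun μ (t n)).re)⁻¹ : ℝ)‖ ≤ B := by
  obtain ⟨B, hB⟩ := exists_uniform_bound_of_quasi_subadditive
    (h := fun n s => (1 - (charFun μ (s * t n)).re) / (1 - (charFun μ (t n)).re))
    (fun n => by
      have := (continuous_charFun (μ := μ))
      fun_prop) (fun n s => by simp [charFun_neg]) (fun n s r => by
      rw [← mul_div_assoc, ← mul_div_assoc, ← add_div]
      refine div_le_div_of_nonneg_right ?_ (one_sub_re_charFun_nonneg μ _)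
      rw [add_mul]
      exact one_sub_re_charFun_add_le μ _ _) (fun s => by
      obtain ⟨B, hB⟩ := ((h.tendsto_re hk s).comp ht).bddAbove_range
      exact ⟨B, fun n => hB ⟨n, rfl⟩⟩) L
  obtain ⟨δ, hδ, him⟩ := h.exists_abs_im_le
  have ht0 : Tendsto (fun n => (|L| + 1) * |t n|) atTop (nhds 0) := by
    have h1 := (tendsto_nhds_of_tendsto_nhdsWithin ht).abs.const_mul (|L| + 1)
    simpa using h1
  refine ⟨(1 + (|c| + 1)) * B, ?_⟩
  filter_upwards [ht0.eventually_lt_const hδ] with n hn s hs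
  have hd := one_sub_re_charFun_nonneg μ (t n)
  have hu : |s * t n| < δ := by
    rw [abs_mul]
    refine lt_of_le_of_lt (mul_le_mul_of_nonneg_right ?_ (abs_nonneg _)) hn
    linarith [le_abs_self L]
  have hn1 : ‖1 - charFun μ (s * t n)‖ ≤ (1 + (|c| + 1)) * (1 - (charFun μ (s * t n)).re) := by
    refine (Complex.norm_le_abs_re_add_abs_im _).trans ?_
    have := him _ hu
    simp only [sub_re, one_re, sub_im, one_im, zero_sub, abs_neg]
    rw [abs_of_nonneg (one_sub_re_charFun_nonneg μ (s * t n))]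
    linarith
  rw [norm_mul, Complex.norm_real, Real.norm_of_nonneg (inv_nonneg.2 hd)]
  calc _ ≤ (1 + (|c| + 1)) * (1 - (charFun μ (s * t n)).re) * (1 - (charFun μ (t n)).re)⁻¹ :=
        mul_le_mul_of_nonneg_right hn1 (inv_nonneg.2 hd)
    _ = (1 + (|c| + 1)) * ((1 - (charFun μ (s * t n)).re) / (1 - (charFun μ (t n)).re)) := by
        rw [div_eq_mul_inv, mul_assoc]
    _ ≤ _ := mul_le_mul_of_nonneg_left (hB n s hs) (by positivity)

lemma tendsto_avgDiff (h : RegularlyVaryingAtZero μ k c) (hk : 0 < k) {t : ℕ → ℝ}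
    (ht : Tendsto t atTop (nhdsWithin 0 (Set.Ioi 0))) (s : ℝ) :
    Tendsto (fun n => avgDiff
      (fun s => (1 - charFun μ (s * t n)) * ((1 - (charFun μ (t n)).re)⁻¹ : ℝ)) s)
      atTop (nhds (avgDiff (stablePsi k c) s)) := by
  obtain ⟨B, hB⟩ := h.exists_norm_le hk ht (|s| + 1)
  have hpt : ∀ s, Tendsto (fun n => (1 - charFun μ (s * t n)) *
      ((1 - (charFun μ (t n)).re)⁻¹ : ℝ)) atTop (nhds (stablePsi k c s)) := fun s =>
    (h.tendsto_one_sub_charFun hk s).comp ht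
  refine Tendsto.sub (Tendsto.const_mul _ ?_) (hpt s)
  refine intervalIntegral.tendsto_integral_filter_of_dominated_convergence (fun _ => B) ?_ ?_
    intervalIntegrable_const ?_
  · refine Eventually.of_forall fun n => Continuous.aestronglyMeasurable ?_
    have := (continuous_charFun (μ := μ))
    fun_prop
  · filter_upwards [hB] with n hn
    refine Eventually.of_forall fun r hr => hn _ ?_
    rw [Set.uIoc_of_le (by norm_num)] at hr
    have : |r| ≤ 1 := abs_le.2 ⟨hr.1.le, hr.2⟩
    linarith [abs_add_le s r]
  · exact Eventually.of_forall fun r _ => hpt _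

end RegularlyVaryingAtZero

lemma exists_le_one_sub_sinc : ∃ ε > (0 : ℝ), ∀ x : ℝ, 1 / 2 ≤ x → ε ≤ 1 - Real.sinc x := by
  obtain ⟨y, hy, hmin⟩ := isCompact_Icc.exists_isMinOn (s := Set.Icc (1 / 2 : ℝ) 2)
    ⟨1, by norm_num, by norm_num⟩
    (f := fun x => 1 - Real.sinc x) (continuous_const.sub Real.continuous_sinc).continuousOn
  have hy0 : 0 < y := by linarith [hy.1]
  have hpos : 0 < 1 - Real.sinc y := by
    rw [Real.sinc_of_ne_zero hy0.ne', sub_pos, div_lt_one hy0]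
    exact Real.sin_lt hy0
  refine ⟨min (1 - Real.sinc y) (1 / 2), by positivity, fun x hx => ?_⟩
  rcases le_total x 2 with h | h
  · exact (min_le_left _ _).trans (hmin ⟨hx, h⟩)
  · refine (min_le_right _ _).trans ?_
    have h1 := Real.sinc_le_inv_abs (x := x) (by linarith)
    rw [abs_of_pos (by linarith)] at h1
    have h2 : x⁻¹ ≤ 2⁻¹ := inv_anti₀ two_pos h
    linarith

lemma exists_boundedContinuousFunction_mul_one_sub_sinc {p : ℝ → ℝ} (hp : Continuous p)
    (hp1 : ∀ x, |p x| ≤ 1) (hp0 : ∀ x ≤ 1 / 2, p x = 0) :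
    ∃ f : BoundedContinuousFunction ℝ ℝ, (∀ x ≤ 0, f x = 0) ∧
      ∀ x, (1 - Real.sinc x) * f x = p x := by
  obtain ⟨ε, hε, hle⟩ := exists_le_one_sub_sinc
  have hden : ∀ x, 0 < max ε (1 - Real.sinc x) := fun x => hε.trans_le (le_max_left _ _)
  have hcont : Continuous fun x => p x / max ε (1 - Real.sinc x) :=
    hp.div (continuous_const.max (continuous_const.sub Real.continuous_sinc))
      fun x => (hden x).ne'
  refine ⟨BoundedContinuousFunction.ofNormedAddCommGroup _ hcont (1 / ε) fun x => ?_,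
    fun x hx => ?_, fun x => ?_⟩
  · rw [Real.norm_eq_abs, abs_div, abs_of_pos (hden x)]
    exact div_le_div₀ zero_le_one (hp1 x) hε (le_max_left _ _)
  · simp [hp0 x (by linarith)]
  · rw [BoundedContinuousFunction.coe_ofNormedAddCommGroup]
    rcases le_total x (1 / 2) with h | h
    · simp [hp0 x h]
    · have := hle x h
      rw [max_eq_right this]
      field_simp [(hε.trans_le this).ne']

/-- The `sinc`-weighted law of `x ↦ t x` under `μ`, normalised by `1 - U(t)`. -/
noncomputable def scaledSincMeasure (μ : Measure ℝ) (t : ℝ) : Measure ℝ :=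
  sincMeasure (μ.map fun x => t * x) fun _ => (1 - (charFun μ t).re)⁻¹

section

variable (μ : Measure ℝ) [IsProbabilityMeasure μ]

lemma norm_compExp_zero_mul_inv_le (t x s : ℝ) :
    ‖compExp 0 s x * ((1 - (charFun μ t).re)⁻¹ : ℝ)‖ ≤
      (2 + |s|) ^ 2 * (1 - (charFun μ t).re)⁻¹ := by
  have hd := inv_nonneg.2 (one_sub_re_charFun_nonneg μ t)
  rw [norm_mul, Complex.norm_real, Real.norm_of_nonneg hd]
  refine mul_le_mul_of_nonneg_right ?_ hd
  have h1 : ‖compExp 0 s x‖ ≤ 2 := by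
    rw [compExp]
    have := norm_sub_le (1 : ℂ) (cexp (s * x * I))
    rw [← Complex.ofReal_mul, Complex.norm_exp_ofReal_mul_I] at this
    rw [← Complex.ofReal_mul]
    norm_num at this ⊢
    exact this
  nlinarith [abs_nonneg s]

instance isFiniteMeasure_scaledSincMeasure (t : ℝ) : IsFiniteMeasure (scaledSincMeasure μ t) :=
  isFiniteMeasure_sincMeasure (m := 0) (M := fun _ => (1 - (charFun μ t).re)⁻¹) measurable_const
    (integrable_const _) (Eventually.of_forall (norm_compExp_zero_mul_inv_le μ t))

lemma charFun_scaledSincMeasure (t s : ℝ) : charFun (scaledSincMeasure μ t) s =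
    avgDiff (fun s => (1 - charFun μ (s * t)) * ((1 - (charFun μ t).re)⁻¹ : ℝ)) s := by
  rw [scaledSincMeasure, charFun_sincMeasure (m := 0) (M := fun _ => (1 - (charFun μ t).re)⁻¹)
    measurable_const
    (Eventually.of_forall fun _ => inv_nonneg.2 (one_sub_re_charFun_nonneg μ t))
    (integrable_const _) (Eventually.of_forall (norm_compExp_zero_mul_inv_le μ t))]
  congr 1
  funext r
  have : IsProbabilityMeasure (μ.map fun x => t * x) :=
    Measure.isProbabilityMeasure_map (by fun_prop)
  have h := charFun_map_mul (μ := μ) t r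
  rw [mul_comm t r] at h
  rw [integral_mul_const, ← h]
  congr 1
  simp only [compExp, ofReal_zero, zero_mul, add_zero]
  rw [integral_sub (integrable_const 1) (integrable_cexp_mul_I r _)]
  simp [charFun_apply_real]

lemma integral_scaledSincMeasure (t : ℝ) {f p : ℝ → ℝ} (hp : Continuous p)
    (hfp : ∀ x, (1 - Real.sinc x) * f x = p x) :
    ∫ x, f x ∂(scaledSincMeasure μ t) = (∫ x, p (t * x) ∂μ) / (1 - (charFun μ t).re) := by
  rw [scaledSincMeasure, integral_sincMeasure measurable_const
    (Eventually.of_forall fun _ => inv_nonneg.2 (one_sub_re_charFun_nonneg μ t)),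
    div_eq_mul_inv, ← integral_mul_const,
    ← integral_map (φ := fun x => t * x) (f := fun y => p y * (1 - (charFun μ t).re)⁻¹)
      (by fun_prop) (by fun_prop)]
  refine integral_congr_ae (Eventually.of_forall fun x => ?_)
  simp only [smul_eq_mul, ← hfp]
  ring

end

lemma integral_stableSincMeasure (k : ℝ) {f p : ℝ → ℝ}
    (hfp : ∀ x, (1 - Real.sinc x) * f x = p x) :
    ∫ x, f x ∂(stableSincMeasure k) = ∫ x in Set.Ioi 0, p x * x ^ (-1 - k) := by
  rw [stableSincMeasure, integral_sincMeasure (by fun_prop)]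
  · refine integral_congr_ae (Eventually.of_forall fun x => ?_)
    simp only [smul_eq_mul, ← hfp]
    ring
  · filter_upwards [ae_restrict_mem measurableSet_Ioi] with x hx
    exact Real.rpow_nonneg (le_of_lt hx) _

lemma integral_map_neg_stableSincMeasure (k : ℝ) {f : ℝ → ℝ} (hf : Continuous f)
    (hf0 : ∀ x ≤ 0, f x = 0) :
    ∫ x, f x ∂((stableSincMeasure k).map fun x => -x) = 0 := by
  rw [integral_map (by fun_prop) (by fun_prop), stableSincMeasure,
    integral_sincMeasure (by fun_prop)]
  · refine integral_eq_zero_of_ae ?_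
    filter_upwards [ae_restrict_mem measurableSet_Ioi] with x hx
    rw [hf0 _ (neg_nonpos.2 (le_of_lt hx))]
    simp
  · filter_upwards [ae_restrict_mem measurableSet_Ioi] with x hx
    exact Real.rpow_nonneg (le_of_lt hx) _

/-- Vague convergence of the normalised rescaled laws to the stable Lévy measure. -/
lemma exists_tendsto_integral_comp_mul {k : ℝ} (hk : 0 < k) (hk2 : k < 2) (hk1 : k ≠ 1) :
    ∃ C : ℝ, 0 < C ∧ ∀ (μ : Measure ℝ) (c : ℝ), IsProbabilityMeasure μ →
      RegularlyVaryingAtZero μ k c → ∀ p : ℝ → ℝ, Continuous p → (∀ x, |p x| ≤ 1) →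
      (∀ x ≤ 1 / 2, p x = 0) →
      Tendsto (fun t => (∫ x, p (t * x) ∂μ) / (1 - (charFun μ t).re))
        (nhdsWithin 0 (Set.Ioi 0)) (nhds ((1 + c / Real.tan (Real.pi * k / 2)) / (2 * C) *
          ∫ x in Set.Ioi 0, p x * x ^ (-1 - k))) := by
  obtain ⟨hfin, C, hC, hcomb⟩ := exists_combination_charFun_eq_avgDiff_stablePsi hk hk2 hk1
  refine ⟨C, hC, fun μ c _ h p hp hp1 hp0 => ?_⟩
  obtain ⟨f, hf0, hf⟩ := exists_boundedContinuousFunction_mul_one_sub_sinc hp hp1 hp0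
  refine tendsto_of_seq_tendsto fun t ht => ?_
  have hlim := tendsto_integral_of_tendsto_charFun_combination
    (ρ := fun n => scaledSincMeasure μ (t n)) (ρ₁ := stableSincMeasure k)
    (ρ₂ := (stableSincMeasure k).map fun x => -x) (fun s => by
      rw [hcomb c s]
      simp only [charFun_scaledSincMeasure]
      exact h.tendsto_avgDiff hk ht s) f
  rw [integral_map_neg_stableSincMeasure k f.continuous hf0, integral_stableSincMeasure k hf,
    mul_zero, add_zero] at hlim
  simpa only [integral_scaledSincMeasure μ _ hp hf, Function.comp_def] using hlim

/-- The piecewise linear function `x ↦ n (x - 1) + b` clamped to `[0, 1]`. -/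
noncomputable def ramp (n b x : ℝ) : ℝ := max 0 (min 1 (n * (x - 1) + b))

lemma continuous_ramp (n b : ℝ) : Continuous (ramp n b) := by
  unfold ramp
  fun_prop

lemma ramp_nonneg (n b x : ℝ) : 0 ≤ ramp n b x := le_max_left _ _

lemma ramp_le_one (n b x : ℝ) : ramp n b x ≤ 1 := max_le zero_le_one (min_le_left _ _)

lemma abs_ramp_le_one (n b x : ℝ) : |ramp n b x| ≤ 1 := by
  rw [abs_of_nonneg (ramp_nonneg n b x)]
  exact ramp_le_one n b x

lemma ramp_eq_zero {n b x : ℝ} (h : n * (x - 1) + b ≤ 0) : ramp n b x = 0 :=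
  max_eq_left ((min_le_right _ _).trans h)

lemma ramp_eq_one {n b x : ℝ} (h : 1 ≤ n * (x - 1) + b) : ramp n b x = 1 := by
  rw [ramp, min_eq_left h, max_eq_right zero_le_one]

lemma ramp_eq_zero_of_le_half {n b x : ℝ} (hn : 2 ≤ n) (hb : b ≤ 1) (hx : x ≤ 1 / 2) :
    ramp n b x = 0 := ramp_eq_zero (by nlinarith)

lemma tendsto_integral_ramp_mul_rpow {k : ℝ} (hk : 0 < k) {b : ℝ} (hb : b ≤ 1) :
    Tendsto (fun n : ℕ => ∫ x in Set.Ioi (0 : ℝ), ramp (n + 2) b x * x ^ (-1 - k)) atTop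
      (nhds (1 / k)) := by
  have hJ : ∫ x in Set.Ioi (0 : ℝ), (Set.Ioi (1 : ℝ)).indicator (fun x => x ^ (-1 - k)) x =
      1 / k := by
    rw [setIntegral_indicator measurableSet_Ioi, Set.inter_eq_self_of_subset_right
      (Set.Ioi_subset_Ioi zero_le_one), integral_Ioi_rpow_of_lt (by linarith) one_pos,
      Real.one_rpow, show -1 - k + 1 = -k by ring, neg_div_neg_eq]
  rw [← hJ]
  refine tendsto_integral_of_dominated_convergence
    ((Set.Ioi (1 / 2 : ℝ)).indicator fun x => x ^ (-1 - k)) (fun n => ?_) ?_ (fun n => ?_) ?_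
  · have := (continuous_ramp (n + 2) b).measurable
    exact (by fun_prop : Measurable _).aestronglyMeasurable
  · refine Integrable.integrableOn ?_
    rw [integrable_indicator_iff measurableSet_Ioi]
    exact integrableOn_Ioi_rpow_of_lt (by linarith) (by norm_num)
  · filter_upwards [ae_restrict_mem measurableSet_Ioi] with x hx
    have hr : 0 ≤ x ^ (-1 - k) := Real.rpow_nonneg (le_of_lt hx) _
    by_cases h : x ∈ Set.Ioi (1 / 2 : ℝ)
    · rw [Set.indicator_of_mem h, norm_mul, Real.norm_of_nonneg hr, Real.norm_eq_abs]
      exact mul_le_of_le_one_left hr (abs_ramp_le_one _ _ _)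
    · rw [Set.indicator_of_notMem h, ramp_eq_zero_of_le_half
        (by linarith [Nat.cast_nonneg (α := ℝ) n]) hb (not_lt.1 h)]
      simp
  · have hae : ∀ᵐ x ∂(volume.restrict (Set.Ioi (0 : ℝ))), x ≠ 1 :=
      ae_restrict_of_ae (Measure.ae_ne volume 1)
    filter_upwards [hae] with x hx
    refine tendsto_const_nhds.congr' ?_
    have hcast : Tendsto (fun n : ℕ => (n : ℝ) + 2) atTop atTop :=
      tendsto_atTop_add_const_right _ _ tendsto_natCast_atTop_atTop
    rcases hx.lt_or_gt with h | h
    · have ht : Tendsto (fun n : ℕ => ((n : ℝ) + 2) * (x - 1) + b) atTop atBot :=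
        tendsto_atBot_add_const_right _ _ (hcast.atTop_mul_const_of_neg (sub_neg.2 h))
      filter_upwards [ht.eventually_le_atBot 0] with n hn
      rw [ramp_eq_zero hn, Set.indicator_of_notMem (by simpa using h.le), zero_mul]
    · have ht : Tendsto (fun n : ℕ => ((n : ℝ) + 2) * (x - 1) + b) atTop atTop :=
        tendsto_atTop_add_const_right _ _ (hcast.atTop_mul_const (sub_pos.2 h))
      filter_upwards [ht.eventually_ge_atTop 1] with n hn
      rw [ramp_eq_one hn, Set.indicator_of_mem (by simpa using h), one_mul]

/-- The intermediate upper tail `(μ[x,∞) + μ(x,∞))/2`. -/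
noncomputable def upperTail (μ : Measure ℝ) (x : ℝ) : ℝ :=
  (μ.real (Set.Ici x) + μ.real (Set.Ioi x)) / 2

section

variable (μ : Measure ℝ) [IsProbabilityMeasure μ]

lemma integrable_ramp_comp_mul (n b t : ℝ) : Integrable (fun x => ramp n b (t * x)) μ := by
  have := continuous_ramp n b
  exact Integrable.of_bound (by fun_prop) 1 (Eventually.of_forall fun x => abs_ramp_le_one _ _ _)

lemma integral_ramp_zero_le_upperTail {n t : ℝ} (hn : 0 ≤ n) (ht : 0 < t) :
    ∫ x, ramp n 0 (t * x) ∂μ ≤ upperTail μ (1 / t) := by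
  have h1 : ∫ x, ramp n 0 (t * x) ∂μ ≤ μ.real (Set.Ioi (1 / t)) := by
    rw [← integral_indicator_one measurableSet_Ioi]
    refine integral_mono (integrable_ramp_comp_mul μ n 0 t)
      ((integrable_const (1 : ℝ)).indicator measurableSet_Ioi) fun x => ?_
    by_cases h : x ∈ Set.Ioi (1 / t)
    · rw [Set.indicator_of_mem h]
      exact ramp_le_one n 0 (t * x)
    · rw [Set.indicator_of_notMem h]
      rw [Set.mem_Ioi, not_lt, le_div_iff₀ ht] at h
      exact (ramp_eq_zero (by nlinarith)).le
  have h2 : μ.real (Set.Ioi (1 / t)) ≤ μ.real (Set.Ici (1 / t)) :=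
    measureReal_mono Set.Ioi_subset_Ici_self
  rw [upperTail]
  linarith

lemma upperTail_le_integral_ramp_one {n t : ℝ} (hn : 0 ≤ n) (ht : 0 < t) :
    upperTail μ (1 / t) ≤ ∫ x, ramp n 1 (t * x) ∂μ := by
  have h1 : μ.real (Set.Ici (1 / t)) ≤ ∫ x, ramp n 1 (t * x) ∂μ := by
    rw [← integral_indicator_one measurableSet_Ici]
    refine integral_mono ((integrable_const (1 : ℝ)).indicator measurableSet_Ici)
      (integrable_ramp_comp_mul μ n 1 t) fun x => ?_
    by_cases h : x ∈ Set.Ici (1 / t)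
    · rw [Set.indicator_of_mem h]
      rw [Set.mem_Ici, div_le_iff₀ ht] at h
      exact (ramp_eq_one (by nlinarith)).ge
    · rw [Set.indicator_of_notMem h]
      exact ramp_nonneg _ _ _
  have h2 : μ.real (Set.Ioi (1 / t)) ≤ μ.real (Set.Ici (1 / t)) :=
    measureReal_mono Set.Ioi_subset_Ici_self
  rw [upperTail]
  linarith

end

lemma exists_tendsto_upperTail {k : ℝ} (hk : 0 < k) (hk2 : k < 2) (hk1 : k ≠ 1) :
    ∃ C : ℝ, 0 < C ∧ ∀ (μ : Measure ℝ) (c : ℝ), IsProbabilityMeasure μ →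
      RegularlyVaryingAtZero μ k c →
      Tendsto (fun t => upperTail μ (1 / t) / (1 - (charFun μ t).re))
        (nhdsWithin 0 (Set.Ioi 0)) (nhds ((1 + c / Real.tan (Real.pi * k / 2)) * C)) := by
  obtain ⟨C, hC, hlim⟩ := exists_tendsto_integral_comp_mul hk hk2 hk1
  refine ⟨1 / (2 * C) * (1 / k), by positivity, fun μ c hμ h => ?_⟩
  have e : (1 + c / Real.tan (Real.pi * k / 2)) * (1 / (2 * C) * (1 / k)) =
      (1 + c / Real.tan (Real.pi * k / 2)) / (2 * C) * (1 / k) := by ring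
  rw [e]
  have hn : ∀ n : ℕ, (2 : ℝ) ≤ n + 2 := fun n => by linarith [Nat.cast_nonneg (α := ℝ) n]
  have hramp : ∀ {b : ℝ}, b ≤ 1 → ∀ n : ℕ, _ := fun {b} hb (n : ℕ) =>
    hlim μ c hμ h (ramp (n + 2) b) (continuous_ramp _ _) (abs_ramp_le_one _ _)
      fun x hx => ramp_eq_zero_of_le_half (hn n) hb hx
  refine tendsto_order.2 ⟨fun y hy => ?_, fun y hy => ?_⟩
  · obtain ⟨n, hyn⟩ := (((tendsto_integral_ramp_mul_rpow hk zero_le_one).const_mul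
      _).eventually_const_lt hy).exists
    filter_upwards [(hramp zero_le_one n).eventually_const_lt hyn, self_mem_nhdsWithin]
      with t ht ht0
    exact ht.trans_le (div_le_div_of_nonneg_right
      (integral_ramp_zero_le_upperTail μ (zero_le_two.trans (hn n)) ht0)
      (one_sub_re_charFun_nonneg μ t))
  · obtain ⟨n, hyn⟩ := (((tendsto_integral_ramp_mul_rpow hk le_rfl).const_mul
      _).eventually_lt_const hy).exists
    filter_upwards [(hramp le_rfl n).eventually_lt_const hyn, self_mem_nhdsWithin]
      with t ht ht0
    exact (div_le_div_of_nonneg_right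
      (upperTail_le_integral_ramp_one μ (zero_le_two.trans (hn n)) ht0)
      (one_sub_re_charFun_nonneg μ t)).trans_lt ht

lemma charFun'_eq_charFun (μ : Measure ℝ) (t : ℝ) : charFun' μ t = charFun μ t := by
  rw [charFun', charFun_apply_real]
  refine integral_congr_ae (Eventually.of_forall fun x => ?_)
  simp only
  ring_nf

lemma one_sub_interDF (μ : Measure ℝ) [IsProbabilityMeasure μ] (x : ℝ) :
    1 - interDF μ x = upperTail μ x := by
  have h1 : μ.real (Set.Ici x) = 1 - μ.real (Set.Iio x) := by
    rw [← Set.compl_Iio, probReal_compl_eq_one_sub measurableSet_Iio]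
  have h2 : μ.real (Set.Ioi x) = 1 - μ.real (Set.Iic x) := by
    rw [← Set.compl_Iic, probReal_compl_eq_one_sub measurableSet_Iic]
  rw [upperTail, h1, h2, interDF]
  simp only [Measure.real]
  ring

lemma interDF_neg (μ : Measure ℝ) (x : ℝ) : interDF μ (-x) = upperTail (μ.map fun x => -x) x := by
  have hm : Measurable fun x : ℝ => -x := measurable_neg
  rw [upperTail, map_measureReal_apply hm measurableSet_Ici,
    map_measureReal_apply hm measurableSet_Ioi, interDF]
  simp only [Set.neg_preimage, Set.neg_Ici, Set.neg_Ioi]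
  simp only [Measure.real]
  ring

lemma upperTail_nonneg (μ : Measure ℝ) (x : ℝ) : 0 ≤ upperTail μ x := by
  unfold upperTail
  positivity

theorem stmt19 (μ : Measure ℝ) [IsProbabilityMeasure μ] (k c' : ℝ)
    (hk : 0 < k) (hk2 : k < 2) (hk1 : k ≠ 1)
    (hpos : ∃ δ > (0 : ℝ), ∀ t ∈ Set.Ioo (0 : ℝ) δ, 0 < 1 - (charFun' μ t).re)
    (hrv : ∀ l : ℝ, 0 < l →
      Tendsto (fun t : ℝ => (1 - (charFun' μ (l * t)).re) / (1 - (charFun' μ t).re))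
        (nhdsWithin 0 (Set.Ioi 0)) (nhds (l ^ k)))
    (hV : Tendsto (fun t : ℝ => (charFun' μ t).im / (1 - (charFun' μ t).re))
      (nhdsWithin 0 (Set.Ioi 0)) (nhds c')) :
    (∀ᶠ x in atTop, 0 < tailSum μ x) ∧
    ∃ β : ℝ, β ∈ Set.Icc (-1 : ℝ) 1 ∧
      Tendsto (fun x : ℝ => tailDiff μ x / tailSum μ x) atTop (nhds β) ∧
      c' = β * Real.tan (Real.pi * k / 2) := by
  simp only [charFun'_eq_charFun] at hpos hrv hV
  have hμ : RegularlyVaryingAtZero μ k c' := by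
    obtain ⟨δ, hδ, h⟩ := hpos
    exact ⟨mem_of_superset (Ioo_mem_nhdsGT hδ) h, hrv, hV⟩
  have hprob : IsProbabilityMeasure (μ.map fun x => -x) :=
    Measure.isProbabilityMeasure_map (by fun_prop)
  obtain ⟨C, hC, hlim⟩ := exists_tendsto_upperTail hk hk2 hk1
  have hT := tan_pi_mul_div_two_ne_zero hk hk2 hk1
  have hR := hlim μ c' inferInstance hμ
  have hL := hlim (μ.map fun x => -x) (-c') hprob hμ.map_neg
  set T := Real.tan (Real.pi * k / 2)
  have hre : ∀ t, (charFun (μ.map fun x => -x) t).re = (charFun μ t).re := fun t => by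
    simp [charFun_map_neg, charFun_neg]
  simp only [hre] at hL
  have hsum_eq : ∀ x, tailSum μ x = upperTail μ x + upperTail (μ.map fun x => -x) x := fun x => by
    rw [tailSum, one_sub_interDF, interDF_neg]
  have hdiff_eq : ∀ x, tailDiff μ x = upperTail μ x - upperTail (μ.map fun x => -x) x := fun x => by
    rw [tailDiff, one_sub_interDF, interDF_neg]
  have hinv : Tendsto (fun x : ℝ => 1 / x) atTop (nhdsWithin 0 (Set.Ioi 0)) := by
    simpa only [one_div] using tendsto_inv_atTop_nhdsGT_zero (𝕜 := ℝ)
  have hsum : Tendsto (fun x => tailSum μ x / (1 - (charFun μ (1 / x)).re)) atTop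
      (nhds (2 * C)) := by
    have h := (hR.add hL).comp hinv
    rw [show (1 + c' / T) * C + (1 + -c' / T) * C = 2 * C by ring] at h
    refine h.congr fun x => ?_
    simp only [Function.comp_apply, one_div_one_div, hsum_eq, add_div]
  have hdiff : Tendsto (fun x => tailDiff μ x / (1 - (charFun μ (1 / x)).re)) atTop
      (nhds (c' / T * (2 * C))) := by
    have h := (hR.sub hL).comp hinv
    rw [show (1 + c' / T) * C - (1 + -c' / T) * C = c' / T * (2 * C) by ring] at h
    refine h.congr fun x => ?_
    simp only [Function.comp_apply, one_div_one_div, hdiff_eq, sub_div]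
  have hden := hinv.eventually hμ.pos
  have hHpos : ∀ᶠ x in atTop, 0 < tailSum μ x := by
    filter_upwards [hden, hsum.eventually_const_lt (by positivity : 0 < 2 * C)] with x h1 h2
    exact (div_pos_iff_of_pos_right h1).1 h2
  have hratio : Tendsto (fun x : ℝ => tailDiff μ x / tailSum μ x) atTop (nhds (c' / T)) := by
    have h := hdiff.div hsum (by positivity)
    rw [mul_div_cancel_right₀ _ (by positivity)] at h
    refine h.congr' ?_
    filter_upwards [hden] with x hx
    exact div_div_div_cancel_right₀ hx.ne' _ _
  refine ⟨hHpos, c' / T, isClosed_Icc.mem_of_tendsto hratio ?_, hratio,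
    (div_mul_cancel₀ c' hT).symm⟩
  filter_upwards [hHpos] with x hx
  have h1 := upperTail_nonneg μ x
  have h2 := upperTail_nonneg (μ.map fun x => -x) x
  rw [Set.mem_Icc, le_div_iff₀ hx, div_le_iff₀ hx, hsum_eq, hdiff_eq]
  constructor <;> linarith
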